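/- arXiv:2403.14207 — 2 statements merged into one kernel-verified Lean document; each statement's English description precedes it below -/
import Mathlib

section
/- For positive integers n and m, there exists an S³-equivariant continuous map from the unit sphere S^{4n−1} of ℍⁿ to the unit sphere S^{4m−1} of ℍᵐ (equivariant with respect to the unit-quaternion actions by componentwise left multiplication) if and only if n ≤ m. -/
open scoped Quaternion

/-- The unit sphere `S^{4n-1}` in quaternionic `n`-space `ℍⁿ` (with the Euclidean
`L²` norm). -/
abbrev QSphere (n : ℕ) : Type :=
  Metric.sphere (0 : PiLp 2 fun _ : Fin n => ℍ[ℝ]) 1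

/-! ### Mod 2 ordered chains -/

/-- Mod 2 chains spanned by finite sequences of points; a sequence of length `k + 1` is an
ordered `k`-simplex, and the empty sequence is the augmentation simplex. -/
abbrev OrderedChain (X : Type*) : Type _ := List X →₀ ZMod 2

namespace OrderedChain

variable {X Y : Type*}

/-- The cone over a chain with apex `v`. -/
noncomputable def cone (v : X) : OrderedChain X →ₗ[ZMod 2] OrderedChain X :=
  Finsupp.lmapDomain _ _ (List.cons v)

/-- The chain map induced by a map of points. -/
noncomputable def push (f : X → Y) : OrderedChain X →ₗ[ZMod 2] OrderedChain Y :=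
  Finsupp.lmapDomain _ _ (List.map f)

/-- The boundary of a simplex. -/
noncomputable def bdryList : List X → OrderedChain X
  | [] => 0
  | v :: l => Finsupp.single l 1 + cone v (bdryList l)

/-- The (augmented) boundary operator. -/
noncomputable def bdry : OrderedChain X →ₗ[ZMod 2] OrderedChain X :=
  Finsupp.linearCombination (ZMod 2) bdryList

/-- The prism over a simplex, whose bottom is its image under `a` and whose top is its image
under `b`. -/
noncomputable def prismList (a b : X → Y) : List X → OrderedChain Y
  | [] => 0
  | v :: l => Finsupp.single (a v :: b v :: l.map b) 1 + cone (a v) (prismList a b l)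

/-- The prism operator between two maps. -/
noncomputable def prism (a b : X → Y) : OrderedChain X →ₗ[ZMod 2] OrderedChain Y :=
  Finsupp.linearCombination (ZMod 2) (prismList a b)

@[simp] lemma cone_single (v : X) (l : List X) (r : ZMod 2) :
    cone v (Finsupp.single l r) = Finsupp.single (v :: l) r := by
  simp [cone]

@[simp] lemma push_single (f : X → Y) (l : List X) (r : ZMod 2) :
    push f (Finsupp.single l r) = Finsupp.single (l.map f) r := by
  simp [push]

@[simp] lemma bdry_single (l : List X) (r : ZMod 2) :
    bdry (Finsupp.single l r) = r • bdryList l := by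
  simp [bdry]

@[simp] lemma prism_single (a b : X → Y) (l : List X) (r : ZMod 2) :
    prism a b (Finsupp.single l r) = r • prismList a b l := by
  simp [prism]

lemma add_self (c : OrderedChain X) : c + c = 0 := by
  ext l
  exact CharTwo.add_self_eq_zero _

lemma bdry_cone (v : X) (c : OrderedChain X) : bdry (cone v c) = c + cone v (bdry c) := by
  induction c using Finsupp.induction_linear with
  | zero => simp
  | add c d hc hd => simp only [map_add, hc, hd]; abel
  | single l r => simp [bdryList]

lemma push_cone (f : X → Y) (v : X) (c : OrderedChain X) :
    push f (cone v c) = cone (f v) (push f c) := by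
  induction c using Finsupp.induction_linear with
  | zero => simp
  | add c d hc hd => simp only [map_add, hc, hd]
  | single l r => simp

lemma bdryList_map (f : X → Y) (l : List X) : bdryList (l.map f) = push f (bdryList l) := by
  induction l with
  | nil => simp [bdryList]
  | cons v l ih => simp [bdryList, push_cone, ih]

lemma bdry_push (f : X → Y) (c : OrderedChain X) : bdry (push f c) = push f (bdry c) := by
  induction c using Finsupp.induction_linear with
  | zero => simp
  | add c d hc hd => simp only [map_add, hc, hd]
  | single l r => simp [bdryList_map]

lemma push_push {Z : Type*} (g : Y → Z) (f : X → Y) (c : OrderedChain X) :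
    push g (push f c) = push (g ∘ f) c := by
  induction c using Finsupp.induction_linear with
  | zero => simp
  | add c d hc hd => simp only [map_add, hc, hd]
  | single l r => simp

lemma push_id (c : OrderedChain X) : push id c = c := by
  induction c using Finsupp.induction_linear with
  | zero => simp
  | add c d hc hd => simp only [map_add, hc, hd]
  | single l r => simp

lemma prism_cone (a b : X → Y) (v : X) (c : OrderedChain X) :
    prism a b (cone v c) = cone (a v) (cone (b v) (push b c)) + cone (a v) (prism a b c) := by
  induction c using Finsupp.induction_linear with
  | zero => simp
  | add c d hc hd => simp only [map_add, hc, hd]; abel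
  | single l r => simp [prismList]

lemma bdry_prismList (a b : X → Y) (l : List X) :
    bdry (prismList a b l) + prism a b (bdryList l) =
      Finsupp.single (l.map a) 1 + Finsupp.single (l.map b) 1 := by
  induction l with
  | nil => simp [prismList, bdryList, add_self]
  | cons v l ih =>
    have h := congrArg (cone (a v)) ih
    simp only [map_add, cone_single] at h
    simp only [prismList, bdryList, map_add, bdry_single, prism_single, bdry_cone, prism_cone,
      one_smul, List.map_cons, bdryList_map, cone_single]
    linear_combination (norm := abel) h + add_self (prismList a b l) +
      add_self (cone (a v) (cone (b v) (push b (bdryList l)))) +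
      add_self (Finsupp.single (a v :: l.map b) (1 : ZMod 2))

lemma bdry_prism (a b : X → Y) (c : OrderedChain X) :
    bdry (prism a b c) + prism a b (bdry c) = push a c + push b c := by
  induction c using Finsupp.induction_linear with
  | zero => simp
  | add c d hc hd =>
    simp only [map_add]
    linear_combination (norm := abel) hc + hd
  | single l r =>
    have h := congrArg (r • ·) (bdry_prismList a b l)
    simpa using h

/-- Chains homotopic through finitely many prisms differ by a boundary. -/
lemma bdry_sum_prism (H : ℕ → X → Y) (z : OrderedChain X) (hz : bdry z = 0) (T : ℕ) :
    bdry (∑ i ∈ Finset.range T, prism (H i) (H (i + 1)) z) = push (H 0) z + push (H T) z := by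
  induction T with
  | zero => simp [add_self]
  | succ T ih =>
    have h := bdry_prism (H T) (H (T + 1)) z
    rw [hz, map_zero, add_zero] at h
    rw [Finset.sum_range_succ, map_add, ih, h]
    linear_combination (norm := abel) add_self (push (H T) z)

/-- Sequences of length `k` in `A` whose points are pairwise at distance at most `ε`. -/
def smallLists [Dist X] (A : Set X) (ε : ℝ) (k : ℕ) : Set (List X) :=
  {l | l.length = k ∧ (∀ x ∈ l, x ∈ A) ∧ ∀ x ∈ l, ∀ y ∈ l, dist x y ≤ ε}

/-- Chains supported on small simplices with `k` vertices in `A`. -/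
noncomputable def small [Dist X] (A : Set X) (ε : ℝ) (k : ℕ) :
    Submodule (ZMod 2) (OrderedChain X) :=
  Finsupp.supported (ZMod 2) (ZMod 2) (smallLists A ε k)

lemma single_mem_small [Dist X] {A : Set X} {ε : ℝ} {k : ℕ} {l : List X}
    (hl : l ∈ smallLists A ε k) (r : ZMod 2) : Finsupp.single l r ∈ small A ε k :=
  Finsupp.single_mem_supported _ _ hl

/-- A linear map sends small chains into a submodule once it does so for small simplices. -/
lemma map_mem_of_mem_small [Dist X] {M : Type*} [AddCommGroup M] [Module (ZMod 2) M]
    {A : Set X} {ε : ℝ} {k : ℕ} (φ : OrderedChain X →ₗ[ZMod 2] M) (S : Submodule (ZMod 2) M)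
    (h : ∀ l ∈ smallLists A ε k, φ (Finsupp.single l 1) ∈ S) {c : OrderedChain X}
    (hc : c ∈ small A ε k) : φ c ∈ S := by
  have hle : small A ε k ≤ S.comap φ := by
    rw [small, Finsupp.supported_eq_span_single, Submodule.span_le]
    rintro _ ⟨l, hl, rfl⟩
    exact h l hl
  exact hle hc

lemma small_mono [Dist X] {A B : Set X} {ε δ : ℝ} {k : ℕ} (hAB : A ⊆ B) (h : ε ≤ δ) :
    small A ε k ≤ small B δ k :=
  Finsupp.supported_mono fun _ hl =>
    ⟨hl.1, fun x hx => hAB (hl.2.1 x hx), fun x hx y hy => (hl.2.2 x hx y hy).trans h⟩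

lemma push_mem_small [Dist X] [Dist Y] {A : Set X} {B : Set Y} {δ ε : ℝ} {k : ℕ} {f : X → Y}
    (hf : ∀ x ∈ A, f x ∈ B) (hd : ∀ x ∈ A, ∀ y ∈ A, dist x y ≤ δ → dist (f x) (f y) ≤ ε)
    {c : OrderedChain X} (hc : c ∈ small A δ k) : push f c ∈ small B ε k := by
  refine map_mem_of_mem_small _ _ (fun l hl => ?_) hc
  rw [push_single]
  refine single_mem_small ⟨by simpa using hl.1, ?_, ?_⟩ _
  · simpa using fun x hx => hf x (hl.2.1 x hx)
  · simpa using fun x hx y hy =>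
      hd x (hl.2.1 x hx) y (hl.2.1 y hy) (hl.2.2 x hx y hy)

lemma cone_mem_small [PseudoMetricSpace X] {A : Set X} {ε : ℝ} (hε : 0 ≤ ε) {k : ℕ} {v : X}
    (hv : v ∈ A) (hd : ∀ x ∈ A, dist v x ≤ ε) {c : OrderedChain X} (hc : c ∈ small A ε k) :
    cone v c ∈ small A ε (k + 1) := by
  refine map_mem_of_mem_small _ _ (fun l hl => ?_) hc
  rw [cone_single]
  refine single_mem_small ⟨by simpa using hl.1, ?_, ?_⟩ _
  · simpa using ⟨hv, hl.2.1⟩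
  · simp only [List.mem_cons]
    rintro x (rfl | hx) y (rfl | hy)
    · simpa using hε
    · exact hd y (hl.2.1 y hy)
    · rw [dist_comm]
      exact hd x (hl.2.1 x hx)
    · exact hl.2.2 x hx y hy

lemma prismList_mem_supported (a b : X → Y) (l : List X) :
    prismList a b l ∈ Finsupp.supported (ZMod 2) (ZMod 2)
      {l' : List Y | l'.length = l.length + 1 ∧ ∀ y ∈ l', ∃ x ∈ l, y = a x ∨ y = b x} := by
  induction l with
  | nil => simp [prismList]
  | cons v l ih =>
    refine add_mem (Finsupp.single_mem_supported _ _ ?_) ?_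
    · refine ⟨by simp, ?_⟩
      simp only [List.mem_cons, List.mem_map]
      rintro y (rfl | rfl | ⟨x, hx, rfl⟩)
      · exact ⟨v, by simp⟩
      · exact ⟨v, by simp⟩
      · exact ⟨x, Or.inr hx, Or.inr rfl⟩
    · refine (Finsupp.supported_comap_lmapDomain (ZMod 2) (ZMod 2) (List.cons (a v)) _)
        (Finsupp.supported_mono ?_ ih)
      rintro l' ⟨hlen, hl'⟩
      refine ⟨by simp [hlen], ?_⟩
      simp only [List.mem_cons]
      rintro y (rfl | hy)
      · exact ⟨v, by simp⟩
      · obtain ⟨x, hx, h⟩ := hl' y hy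
        exact ⟨x, Or.inr hx, h⟩

lemma prism_mem_small [PseudoMetricSpace X] [PseudoMetricSpace Y] {A : Set X} {B : Set Y}
    {δ ε : ℝ} {k : ℕ} {a b : X → Y} (ha : ∀ x ∈ A, a x ∈ B) (hb : ∀ x ∈ A, b x ∈ B)
    (haa : ∀ x ∈ A, ∀ y ∈ A, dist x y ≤ δ → dist (a x) (a y) ≤ ε)
    (hab : ∀ x ∈ A, ∀ y ∈ A, dist x y ≤ δ → dist (a x) (b y) ≤ ε)
    (hbb : ∀ x ∈ A, ∀ y ∈ A, dist x y ≤ δ → dist (b x) (b y) ≤ ε)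
    {c : OrderedChain X} (hc : c ∈ small A δ k) : prism a b c ∈ small B ε (k + 1) := by
  refine map_mem_of_mem_small _ _ (fun l hl => ?_) hc
  rw [prism_single, one_smul]
  refine Finsupp.supported_mono ?_ (prismList_mem_supported a b l)
  rintro l' ⟨hlen, hl'⟩
  refine ⟨by rw [hlen, hl.1], fun y hy => ?_, fun y hy y' hy' => ?_⟩
  · obtain ⟨x, hx, rfl | rfl⟩ := hl' y hy
    · exact ha x (hl.2.1 x hx)
    · exact hb x (hl.2.1 x hx)
  · obtain ⟨x, hx, h⟩ := hl' y hy
    obtain ⟨x', hx', h'⟩ := hl' y' hy'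
    have hxA := hl.2.1 x hx
    have hxA' := hl.2.1 x' hx'
    have hd := hl.2.2 x hx x' hx'
    rcases h with rfl | rfl <;> rcases h' with rfl | rfl
    · exact haa x hxA x' hxA' hd
    · exact hab x hxA x' hxA' hd
    · rw [dist_comm]
      exact hab x' hxA' x hxA (by rwa [dist_comm])
    · exact hbb x hxA x' hxA' hd

end OrderedChain

/-! ### Alternating simplices -/

/-- A multiset of signed labels is alternating with first sign `s` if its labels are distinct and
the signs alternate, beginning with `s`, when the labels are listed in increasing order. -/
inductive Alternating {ι : Type*} [LinearOrder ι] : Bool → Multiset (ι × Bool) → Prop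
  | zero (s : Bool) : Alternating s 0
  | cons (a : ι × Bool) (T : Multiset (ι × Bool)) (hT : ∀ b ∈ T, a.1 < b.1)
      (h : Alternating (!a.2) T) : Alternating a.2 (a ::ₘ T)

namespace Alternating

variable {ι : Type*} [LinearOrder ι]

lemma nodup {s : Bool} {m : Multiset (ι × Bool)} (h : Alternating s m) :
    (m.map Prod.fst).Nodup := by
  induction h with
  | zero => simp
  | cons a T hT _ ih =>
    rw [Multiset.map_cons, Multiset.nodup_cons]
    refine ⟨fun hmem => ?_, ih⟩
    obtain ⟨b, hb, hba⟩ := Multiset.mem_map.1 hmem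
    exact (hT b hb).ne' hba

lemma cons_iff {s : Bool} {a : ι × Bool} {T : Multiset (ι × Bool)} (hT : ∀ b ∈ T, a.1 < b.1) :
    Alternating s (a ::ₘ T) ↔ a.2 = s ∧ Alternating (!s) T := by
  refine ⟨fun h => ?_, ?_⟩
  · generalize hm : a ::ₘ T = m at h
    cases h with
    | zero => simp at hm
    | cons a' T' hT' h =>
      have haa : a = a' := by
        by_contra hne
        have h1 : a ∈ a' ::ₘ T' := hm ▸ Multiset.mem_cons_self a T
        have h2 : a' ∈ a ::ₘ T := hm ▸ Multiset.mem_cons_self a' T'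
        have h1' := hT' a ((Multiset.mem_cons.1 h1).resolve_left hne)
        have h2' := hT a' ((Multiset.mem_cons.1 h2).resolve_left (Ne.symm hne))
        exact lt_asymm h1' h2'
      subst haa
      rw [Multiset.cons_inj_right] at hm
      subst hm
      exact ⟨rfl, h⟩
  · rintro ⟨rfl, h⟩
    exact .cons a T hT h

lemma map_flip {s : Bool} {m : Multiset (ι × Bool)} (h : Alternating s m) :
    Alternating (!s) (m.map fun a => (a.1, !a.2)) := by
  induction h with
  | zero => exact .zero _
  | cons a T hT _ ih =>
    rw [Multiset.map_cons]
    refine .cons (a.1, !a.2) _ (fun b hb => ?_) ih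
    obtain ⟨c, hc, rfl⟩ := Multiset.mem_map.1 hb
    exact hT c hc

lemma map_flip_iff {s : Bool} {m : Multiset (ι × Bool)} :
    Alternating s (m.map fun a => (a.1, !a.2)) ↔ Alternating (!s) m := by
  refine ⟨fun h => ?_, fun h => ?_⟩
  · simpa [Multiset.map_map, Function.comp_def] using h.map_flip
  · simpa using h.map_flip

end Alternating

/-- The sum of the values of `g` on the codimension one faces of a multiset. -/
def Multiset.faceSum {α : Type*} [DecidableEq α] (g : Multiset α → ZMod 2) (m : Multiset α) :
    ZMod 2 :=
  (m.map fun a => g (m.erase a)).sum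

lemma Multiset.faceSum_cons {α : Type*} [DecidableEq α] (g : Multiset α → ZMod 2) (a : α)
    (m : Multiset α) :
    faceSum g (a ::ₘ m) = g m + faceSum (fun u => g (a ::ₘ u)) m := by
  unfold faceSum
  rw [Multiset.map_cons, Multiset.sum_cons, Multiset.erase_cons_head]
  congr 2
  refine Multiset.map_congr rfl fun b hb => ?_
  rw [Multiset.erase_cons_tail_of_mem hb]

section AlternatingCochain

open Classical in
/-- The mod 2 cochain detecting alternating simplices with first sign `s`. -/
noncomputable def altCochain {ι : Type*} [LinearOrder ι] (s : Bool) (m : Multiset (ι × Bool)) :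
    ZMod 2 :=
  if Alternating s m then 1 else 0

variable {ι : Type*} [LinearOrder ι]

lemma altCochain_cons (s : Bool) {a : ι × Bool} {T : Multiset (ι × Bool)}
    (hT : ∀ b ∈ T, a.1 < b.1) :
    altCochain s (a ::ₘ T) = (if a.2 = s then 1 else 0) * altCochain (!s) T := by
  unfold altCochain
  rw [Alternating.cons_iff hT]
  split_ifs <;> simp_all

lemma altCochain_eq_zero_of_cons_cons (s : Bool) (a : ι × Bool) (T : Multiset (ι × Bool)) :
    altCochain s (a ::ₘ a ::ₘ T) = 0 := by
  unfold altCochain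
  rw [if_neg]
  intro h
  simpa using h.nodup

lemma altCochain_flip (s : Bool) (m : Multiset (ι × Bool)) :
    altCochain s (m.map fun a => (a.1, !a.2)) = altCochain (!s) m := by
  classical
  unfold altCochain
  exact if_congr Alternating.map_flip_iff rfl rfl

/-- Among the faces of a simplex without complementary labels, the number of those alternating
with first sign `s` has the parity of the number of alternating orientations of the simplex. -/
lemma faceSum_altCochain (m : Multiset (ι × Bool)) (s : Bool)
    (hm : ∀ a ∈ m, ∀ b ∈ m, a.1 = b.1 → a = b) :
    m.faceSum (altCochain s) = altCochain s m + altCochain (!s) m := by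
  induction hk : m.card generalizing m s with
  | zero =>
    obtain rfl := Multiset.card_eq_zero.1 hk
    simp only [altCochain, Alternating.zero, Multiset.faceSum, if_true]
    exact (CharTwo.add_self_eq_zero _).symm
  | succ k ih =>
    have hne : m.toFinset.Nonempty := by
      rw [Multiset.toFinset_nonempty]
      rintro rfl
      simp at hk
    obtain ⟨a, ha, hmin⟩ := m.toFinset.exists_min_image Prod.fst hne
    simp only [Multiset.mem_toFinset] at ha hmin
    obtain ⟨T, rfl⟩ := Multiset.exists_cons_of_mem ha
    by_cases haT : a ∈ T
    · obtain ⟨T, rfl⟩ := Multiset.exists_cons_of_mem haT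
      simp only [Multiset.faceSum_cons, altCochain_eq_zero_of_cons_cons]
      rw [← add_assoc, CharTwo.add_self_eq_zero]
      simp [Multiset.faceSum]
    · have hT : ∀ b ∈ T, a.1 < b.1 := fun b hb => by
        refine lt_of_le_of_ne (hmin b (Multiset.mem_cons_of_mem hb)) fun h => haT ?_
        rwa [hm a ha b (Multiset.mem_cons_of_mem hb) h]
      have hIH := ih T (!s)
        (fun x hx y hy => hm x (Multiset.mem_cons_of_mem hx) y (Multiset.mem_cons_of_mem hy))
        (by simpa using hk)
      rw [Bool.not_not] at hIH
      have hface : T.faceSum (fun u => altCochain s (a ::ₘ u)) =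
          (if a.2 = s then 1 else 0) * T.faceSum (altCochain (!s)) := by
        unfold Multiset.faceSum
        rw [← Multiset.sum_map_mul_left]
        congr 1
        exact Multiset.map_congr rfl fun b _ =>
          altCochain_cons s fun c hc => hT c (Multiset.mem_of_mem_erase hc)
      rw [Multiset.faceSum_cons, hface, hIH, altCochain_cons s hT, altCochain_cons (!s) hT,
        Bool.not_not]
      have h2 := CharTwo.add_self_eq_zero (altCochain s T)
      by_cases has : a.2 = s
      · have : a.2 ≠ !s := by simp [has]
        rw [if_pos has, if_neg this]
        linear_combination h2
      · have : a.2 = !s := by cases h : a.2 <;> cases s <;> simp_all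
        rw [if_neg has, if_pos this]
        ring

/-- Evaluation of `altCochain s` on chains of labels. -/
noncomputable def altEval (s : Bool) : OrderedChain (ι × Bool) →ₗ[ZMod 2] ZMod 2 :=
  Finsupp.linearCombination (ZMod 2) fun l => altCochain s (l : Multiset (ι × Bool))

lemma linearCombination_bdryList {α : Type*} [DecidableEq α] (g : Multiset α → ZMod 2)
    (l : List α) :
    Finsupp.linearCombination (ZMod 2) (fun l : List α => g l) (OrderedChain.bdryList l) =
      (l : Multiset α).faceSum g := by
  induction l generalizing g with
  | nil => simp [OrderedChain.bdryList, Multiset.faceSum]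
  | cons v l ih =>
    rw [← Multiset.cons_coe, Multiset.faceSum_cons, ← ih, OrderedChain.bdryList, map_add,
      OrderedChain.cone, Finsupp.lmapDomain_apply, Finsupp.linearCombination_mapDomain]
    simp [Function.comp_def]

lemma altEval_push_flip (s : Bool) (c : OrderedChain (ι × Bool)) :
    altEval s (OrderedChain.push (fun a => (a.1, !a.2)) c) = altEval (!s) c := by
  induction c using Finsupp.induction_linear with
  | zero => simp
  | add c d hc hd => simp only [map_add, hc, hd]
  | single l r =>
    have h := altCochain_flip s (l : Multiset (ι × Bool))
    rw [Multiset.map_coe] at h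
    simp [altEval, h]

end AlternatingCochain

/-! ### Filling cycles on spheres and the Borsuk–Ulam theorem -/

section BorsukUlam

open OrderedChain

variable {E : Type*} [NormedAddCommGroup E] [InnerProductSpace ℝ E]

/-- The rotation by angle `t` towards the unit vector `e`, on vectors orthogonal to `e`. -/
noncomputable def rotateTo (e : E) (t : ℝ) (x : E) : E :=
  Real.cos t • x + Real.sin t • e

lemma norm_rotateTo {e x : E} (he : ‖e‖ = 1) (hx : ‖x‖ = 1) (hex : inner ℝ e x = 0) (t : ℝ) :
    ‖rotateTo e t x‖ = 1 := by
  have h : inner ℝ (Real.cos t • x) (Real.sin t • e) = 0 := by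
    rw [inner_smul_left, inner_smul_right, real_inner_comm, hex]
    simp
  have h2 := norm_add_sq_eq_norm_sq_add_norm_sq_real h
  rw [norm_smul, norm_smul, he, hx, mul_one, mul_one, Real.norm_eq_abs, Real.norm_eq_abs,
    abs_mul_abs_self, abs_mul_abs_self] at h2
  have h3 : ‖rotateTo e t x‖ * ‖rotateTo e t x‖ = 1 := by
    rw [rotateTo, h2]
    nlinarith [Real.sin_sq_add_cos_sq t]
  nlinarith [norm_nonneg (rotateTo e t x)]

lemma dist_rotateTo_le {e y : E} (he : ‖e‖ = 1) (hy : ‖y‖ = 1) (x : E) (s t : ℝ) :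
    dist (rotateTo e t x) (rotateTo e s y) ≤ dist x y + 2 * |t - s| := by
  have h : rotateTo e t x - rotateTo e s y =
      Real.cos t • (x - y) + (Real.cos t - Real.cos s) • y + (Real.sin t - Real.sin s) • e := by
    unfold rotateTo
    module
  rw [dist_eq_norm, dist_eq_norm, h]
  refine (norm_add₃_le).trans ?_
  rw [norm_smul, norm_smul, norm_smul, he, hy, mul_one, mul_one]
  simp only [Real.norm_eq_abs]
  have h1 := Real.abs_cos_sub_cos_le t s
  have h2 := Real.abs_sin_sub_sin_le t s
  have h3 := mul_le_of_le_one_left (norm_nonneg (x - y)) (Real.abs_cos_le_one t)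
  linarith

/-- The unit sphere of the orthogonal complement of the `e j` with `k < j`. -/
def subsphere {N : ℕ} (e : Fin N → E) (k : ℕ) : Set E :=
  {x | ‖x‖ = 1 ∧ ∀ j : Fin N, k < j → inner ℝ (e j) x = 0}

lemma neg_mem_subsphere {N : ℕ} {e : Fin N → E} {k : ℕ} {x : E} (hx : x ∈ subsphere e k) :
    -x ∈ subsphere e k :=
  ⟨by rw [norm_neg, hx.1], fun j hj => by rw [inner_neg_right, hx.2 j hj, neg_zero]⟩

lemma mem_subsphere {N : ℕ} {e : Fin N → E} (he : Orthonormal ℝ e) (k : Fin N) :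
    e k ∈ subsphere e k :=
  ⟨he.1 k, fun _ hj => he.2 (Fin.ne_of_gt hj)⟩

lemma rotateTo_mem_subsphere {N : ℕ} {e : Fin N → E} (he : Orthonormal ℝ e) {k : ℕ}
    (hk : k + 1 < N) {x : E} (hx : x ∈ subsphere e k) (t : ℝ) :
    rotateTo (e ⟨k + 1, hk⟩) t x ∈ subsphere e (k + 1) := by
  refine ⟨norm_rotateTo (he.1 _) hx.1 (hx.2 _ (Nat.lt_succ_self k)) t, fun j hj => ?_⟩
  have h1 := hx.2 j ((Nat.lt_succ_self k).trans hj)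
  have h2 : inner ℝ (e j) (e ⟨k + 1, hk⟩) = 0 := he.2 (Fin.ne_of_gt hj)
  simp [rotateTo, inner_add_right, inner_smul_right, h1, h2]

/-- Small cycles in a subsphere bound small chains in the subsphere of one dimension more. -/
lemma exists_small_filling {N : ℕ} {e : Fin N → E} (he : Orthonormal ℝ e) {k : ℕ}
    (hk : k + 1 < N) {ε : ℝ} (hε : 0 < ε) {n : ℕ} {z : OrderedChain E}
    (hz : z ∈ small (subsphere e k) (ε / 2) n) (hbz : bdry z = 0) :
    ∃ w ∈ small (subsphere e (k + 1)) ε (n + 1), bdry w = z := by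
  obtain ⟨T, hT⟩ := exists_nat_gt (2 * Real.pi / ε)
  have hπ := Real.pi_pos
  have hT0 : (0 : ℝ) < T := lt_trans (by positivity) hT
  set p : E := e ⟨k + 1, hk⟩ with hp
  have hp1 : ‖p‖ = 1 := he.1 _
  have hpm : p ∈ subsphere e (k + 1) := mem_subsphere he ⟨k + 1, hk⟩
  set θ : ℕ → ℝ := fun i => i * (Real.pi / 2 / T) with hθ
  set H : ℕ → E → E := fun i => rotateTo p (θ i) with hH
  have hH0 : H 0 = id := by
    funext x
    simp [hH, hθ, rotateTo]
  have hHT : H T = fun _ => p := by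
    funext x
    have : θ T = Real.pi / 2 := by
      simp only [hθ]
      field_simp
    simp [hH, this, rotateTo]
  have hmem : ∀ i, ∀ x ∈ subsphere e k, H i x ∈ subsphere e (k + 1) := fun i x hx =>
    rotateTo_mem_subsphere he hk hx _
  have hstep : ∀ i, 2 * |θ i - θ (i + 1)| ≤ ε / 2 := by
    intro i
    have : θ i - θ (i + 1) = -(Real.pi / 2 / T) := by
      simp only [hθ]
      push_cast
      ring
    rw [this, abs_neg, abs_of_pos (by positivity)]
    rw [div_lt_iff₀ hε] at hT
    have : Real.pi / 2 / T ≤ ε / 4 := by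
      rw [div_le_iff₀ hT0]
      linarith
    linarith
  have hsame : ∀ i, ∀ x ∈ subsphere e k, ∀ y ∈ subsphere e k, dist x y ≤ ε / 2 →
      dist (H i x) (H i y) ≤ ε := by
    intro i x _ y hy hd
    have := dist_rotateTo_le hp1 hy.1 x (θ i) (θ i)
    rw [sub_self, abs_zero] at this
    simp only [hH]
    linarith
  have hnext : ∀ i, ∀ x ∈ subsphere e k, ∀ y ∈ subsphere e k, dist x y ≤ ε / 2 →
      dist (H i x) (H (i + 1) y) ≤ ε := by
    intro i x _ y hy hd
    have := dist_rotateTo_le hp1 hy.1 x (θ (i + 1)) (θ i)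
    have := hstep i
    simp only [hH]
    linarith
  refine ⟨∑ i ∈ Finset.range T, prism (H i) (H (i + 1)) z + cone p (push (H T) z),
    add_mem (sum_mem fun i _ => ?_) ?_, ?_⟩
  · exact prism_mem_small (hmem i) (hmem (i + 1)) (hsame i) (hnext i) (hsame (i + 1)) hz
  · have h : push (H T) z ∈ small {p} ε n := by
      refine push_mem_small (fun x _ => by simp [hHT]) (fun x _ y _ _ => ?_) hz
      simp [hHT, hε.le]
    refine small_mono (Set.singleton_subset_iff.2 hpm) le_rfl (cone_mem_small hε.le (Set.mem_singleton p) ?_ h)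
    rintro x rfl
    simpa using hε.le
  · rw [map_add, bdry_sum_prism H z hbz, bdry_cone, bdry_push, hbz, map_zero, map_zero, add_zero,
      hH0, push_id, add_assoc, OrderedChain.add_self, add_zero]

variable {ι : Type*} [LinearOrder ι]

omit [InnerProductSpace ℝ E] in
/-- An antipodal labelling without small complementary edges evaluates, on small chains, the
boundary operator as the sum of the two alternating cochains. -/
lemma altEval_bdry {A : Set E} {L : E → ι × Bool} {ε : ℝ}
    (hL : ∀ x ∈ A, ∀ y ∈ A, dist x y ≤ ε → (L x).1 = (L y).1 → L x = L y) {k : ℕ}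
    {c : OrderedChain E} (hc : c ∈ small A ε k) (s : Bool) :
    altEval s (push L (bdry c)) = altEval s (push L c) + altEval (!s) (push L c) := by
  have h := map_mem_of_mem_small
    ((altEval s).comp ((push L).comp bdry) - (altEval s).comp (push L) -
      (altEval (!s)).comp (push L)) ⊥ (fun l hl => ?_) hc
  · rw [Submodule.mem_bot] at h
    simp only [LinearMap.sub_apply, LinearMap.comp_apply] at h
    linear_combination h
  · have hf := faceSum_altCochain (l.map L : Multiset (ι × Bool)) s (by
      simp only [Multiset.mem_coe, List.mem_map]
      rintro _ ⟨x, hx, rfl⟩ _ ⟨y, hy, rfl⟩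
      exact hL x (hl.2.1 x hx) y (hl.2.1 y hy) (hl.2.2 x hx y hy))
    rw [← linearCombination_bdryList] at hf
    rw [Submodule.mem_bot]
    simp only [LinearMap.sub_apply, LinearMap.comp_apply, bdry_single, push_single, one_smul,
      ← bdryList_map]
    rw [altEval, hf]
    simp [altEval]

/-- Each subsphere carries a small antipodally symmetric cycle on which the alternating cochain
is nonzero. -/
lemma exists_symmetric_cycle {N : ℕ} {e : Fin N → E} (he : Orthonormal ℝ e) {L : E → ι × Bool}
    {ε₀ : ℝ} (hneg : ∀ x, ‖x‖ = 1 → L (-x) = ((L x).1, !(L x).2))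
    (hL : ∀ x y, ‖x‖ = 1 → ‖y‖ = 1 → dist x y ≤ ε₀ → (L x).1 = (L y).1 → L x = L y)
    (k : ℕ) (hk : k < N) {ε : ℝ} (hε : 0 < ε) (hε₀ : ε ≤ ε₀) :
    ∃ z ∈ small (subsphere e k) ε (k + 1), bdry z = 0 ∧ push Neg.neg z = z ∧
      altEval true (push L z) = 1 := by
  have hnegpush : ∀ {A : Set E} {δ : ℝ} {n : ℕ} {c : OrderedChain E}, A ⊆ {x | ‖x‖ = 1} →
      c ∈ small A δ n → ∀ s, altEval s (push L (push Neg.neg c)) = altEval (!s) (push L c) := by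
    intro A δ n c hA hc s
    rw [← altEval_push_flip, push_push, push_push, ← sub_eq_zero, ← map_sub,
      ← LinearMap.sub_apply, ← LinearMap.comp_apply, ← Submodule.mem_bot (ZMod 2)]
    refine map_mem_of_mem_small _ _ (fun l hl => ?_) hc
    have : l.map (L ∘ Neg.neg) = l.map ((fun a : ι × Bool => (a.1, !a.2)) ∘ L) :=
      List.map_congr_left fun x hx => hneg x (hA (hl.2.1 x hx))
    simp [this]
  induction k generalizing ε with
  | zero =>
    have h0 := mem_subsphere he ⟨0, hk⟩
    set p := e ⟨0, hk⟩
    have hsingle : ∀ x ∈ subsphere e 0,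
        (Finsupp.single [x] 1 : OrderedChain E) ∈ small (subsphere e 0) ε 1 := fun x hx =>
      single_mem_small ⟨rfl, by simpa using hx, by simpa using hε.le⟩ 1
    refine ⟨Finsupp.single [p] 1 + Finsupp.single [-p] 1,
      add_mem (hsingle _ h0) (hsingle _ (neg_mem_subsphere h0)), ?_, ?_, ?_⟩
    · simp [bdryList, OrderedChain.add_self]
    · simp [add_comm]
    · have h := hneg p h0.1
      have halt : ∀ a : ι × Bool, altCochain true {a} = if a.2 = true then 1 else 0 := by
        intro a
        rw [← Multiset.cons_zero, altCochain_cons _ (by simp)]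
        simp [altCochain, Alternating.zero]
      simp only [map_add, push_single, List.map_cons, List.map_nil, h, altEval,
        Finsupp.linearCombination_single, one_smul, Multiset.coe_singleton, halt]
      cases (L p).2 <;> simp
  | succ k ih =>
    obtain ⟨z, hz, hbz, hsymm, hval⟩ := ih ((Nat.lt_succ_self k).trans hk) (half_pos hε)
      (by linarith)
    obtain ⟨w, hw, hbw⟩ := exists_small_filling he hk hε hz hbz
    have hsub : subsphere e (k + 1) ⊆ {x | ‖x‖ = 1} := fun x hx => hx.1
    refine ⟨w + push Neg.neg w, add_mem hw ?_, ?_, ?_, ?_⟩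
    · exact push_mem_small (fun x => neg_mem_subsphere)
        (fun x _ y _ h => by rwa [dist_neg_neg]) hw
    · rw [map_add, bdry_push, hbw, hsymm, OrderedChain.add_self]
    · rw [map_add, push_push, neg_comp_neg, push_id, add_comm]
    · rw [map_add, map_add, hnegpush hsub hw, ← altEval_bdry _ hw, hbw, hval]
      exact fun x hx y hy hd => hL x y hx.1 hy.1 (hd.trans hε₀)

/-- Tucker's lemma for the sphere: an antipodal labelling without small complementary edges needs
at least as many labels as the dimension of the ambient space. -/
theorem le_card_of_antipodal_labelling [Fintype ι] {N : ℕ} {e : Fin N → E}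
    (he : Orthonormal ℝ e) {L : E → ι × Bool} {ε : ℝ} (hε : 0 < ε)
    (hneg : ∀ x, ‖x‖ = 1 → L (-x) = ((L x).1, !(L x).2))
    (hL : ∀ x y, ‖x‖ = 1 → ‖y‖ = 1 → dist x y ≤ ε → (L x).1 = (L y).1 → L x = L y) :
    N ≤ Fintype.card ι := by
  obtain _ | k := N
  · exact Nat.zero_le _
  obtain ⟨z, hz, -, -, hval⟩ :=
    exists_symmetric_cycle he hneg hL k (Nat.lt_succ_self k) hε le_rfl
  by_contra! hlt
  have h := map_mem_of_mem_small ((altEval true).comp (push L)) ⊥ (fun l hl => ?_) hz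
  · rw [Submodule.mem_bot, LinearMap.comp_apply, hval] at h
    exact one_ne_zero h
  · rw [Submodule.mem_bot, LinearMap.comp_apply, push_single, altEval,
      Finsupp.linearCombination_single, one_smul, altCochain, if_neg]
    intro halt
    have hcard := halt.nodup
    rw [Multiset.map_coe, Multiset.coe_nodup] at hcard
    have := hcard.length_le_card
    simp only [List.length_map, hl.1] at this
    exact absurd this (not_le.2 hlt)

/-- **Borsuk–Ulam theorem**: a continuous odd map on the unit sphere of a finite-dimensional inner
product space, with no zero, takes values in a space of at least the same dimension. -/
theorem finrank_le_of_odd_sphere_map [FiniteDimensional ℝ E] {F : Type*} [NormedAddCommGroup F]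
    [NormedSpace ℝ F] [FiniteDimensional ℝ F] (f : Metric.sphere (0 : E) 1 → F)
    (hf : Continuous f) (hodd : ∀ x, f (-x) = -f x) (h0 : ∀ x, f x ≠ 0) :
    Module.finrank ℝ E ≤ Module.finrank ℝ F := by
  classical
  rcases isEmpty_or_nonempty (Metric.sphere (0 : E) 1) with hempty | ⟨⟨x₀⟩⟩
  · suffices Subsingleton E by simp [Module.finrank_zero_of_subsingleton]
    by_contra hns
    rw [not_subsingleton_iff_nontrivial] at hns
    obtain ⟨x, hx⟩ := exists_norm_eq E zero_le_one
    exact hempty.false ⟨x, by simpa using hx⟩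
  let Φ := (Module.finBasis ℝ F).equivFunL
  let g : Metric.sphere (0 : E) 1 → Fin (Module.finrank ℝ F) → ℝ := fun x => Φ (f x)
  have hg : Continuous g := Φ.continuous.comp hf
  have hgodd : ∀ x, g (-x) = -g x := fun x => by simp [g, hodd]
  have hg0 : ∀ x, g x ≠ 0 := fun x => by simpa [g] using h0 x
  have : Nonempty (Fin (Module.finrank ℝ F)) := by
    by_contra hne
    rw [not_nonempty_iff] at hne
    exact hg0 x₀ (Subsingleton.elim _ _)
  obtain ⟨x₁, -, hx₁⟩ := isCompact_univ.exists_isMinOn ⟨x₀, Set.mem_univ _⟩ hg.norm.continuousOn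
  have hc : 0 < ‖g x₁‖ := norm_pos_iff.2 (hg0 x₁)
  obtain ⟨δ, hδ, hgδ⟩ := Metric.uniformContinuous_iff.1
    (CompactSpace.uniformContinuous_of_continuous hg) ‖g x₁‖ hc
  choose idx hidx using fun w : Fin (Module.finrank ℝ F) → ℝ => Finite.exists_max w
  let i : Metric.sphere (0 : E) 1 → Fin (Module.finrank ℝ F) := fun x => idx |g x|
  have hi : ∀ x, ‖g x₁‖ ≤ |g x (i x)| := fun x =>
    (hx₁ (Set.mem_univ x)).trans ((pi_norm_le_iff_of_nonneg (abs_nonneg _)).2 (hidx |g x|))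
  have hineg : ∀ x, i (-x) = i x := fun x => by simp only [i, hgodd, abs_neg]
  let L : E → Fin (Module.finrank ℝ F) × Bool := fun x =>
    if hx : x ∈ Metric.sphere (0 : E) 1 then (i ⟨x, hx⟩, decide (0 < g ⟨x, hx⟩ (i ⟨x, hx⟩)))
    else (i x₀, true)
  have hLval : ∀ x : Metric.sphere (0 : E) 1, L x = (i x, decide (0 < g x (i x))) := fun x =>
    dif_pos x.2
  have key := le_card_of_antipodal_labelling (L := L) (stdOrthonormalBasis ℝ E).orthonormal
    (half_pos hδ) ?_ ?_
  · simpa using key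
  · intro x hx
    lift x to Metric.sphere (0 : E) 1 using by simpa using hx
    have hpos := hc.trans_le (hi x)
    rw [← coe_neg_sphere, hLval, hLval, hineg, hgodd, Pi.neg_apply]
    refine Prod.ext rfl ?_
    rw [← decide_not, decide_eq_decide, Left.neg_pos_iff, not_lt]
    exact ⟨le_of_lt, fun h => h.lt_of_ne (abs_pos.1 hpos)⟩
  · intro x y hx hy hxy
    lift x to Metric.sphere (0 : E) 1 using by simpa using hx
    lift y to Metric.sphere (0 : E) 1 using by simpa using hy
    rw [hLval, hLval]
    intro hxi
    have hxi : i x = i y := hxi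
    refine Prod.ext hxi ?_
    have hd := (dist_le_pi_dist (g x) (g y) (i y)).trans_lt
      (hgδ (show dist x y < δ from hxy.trans_lt (half_lt_self hδ)))
    have h1 := hi x
    have h2 := hi y
    rw [hxi] at h1
    rw [Real.dist_eq, abs_lt] at hd
    rw [decide_eq_decide, hxi]
    constructor
    · intro h
      rw [abs_of_pos h] at h1
      linarith
    · intro h
      rw [abs_of_pos h] at h2
      linarith

end BorsukUlam

lemma finrank_quaternion_space (n : ℕ) :
    Module.finrank ℝ (PiLp 2 fun _ : Fin n => ℍ[ℝ]) = n * 4 := by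
  rw [(WithLp.linearEquiv 2 ℝ (Fin n → ℍ[ℝ])).finrank_eq, Module.finrank_pi_fintype]
  simp [Quaternion.finrank_eq_four]

/-- For positive integers `n`, `m`, there exists an `S³`-equivariant continuous map
`S^{4n-1} → S^{4m-1}` (equivariant for componentwise left multiplication by unit
quaternions) if and only if `n ≤ m`. -/
theorem stmt6 (n m : ℕ) (hn : 0 < n) (hm : 0 < m) :
    (∃ f : QSphere n → QSphere m, Continuous f ∧
      ∀ (q : ℍ[ℝ]), ‖q‖ = 1 → ∀ (x y : QSphere n),
        (∀ i : Fin n, y.1 i = q * x.1 i) →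
        ∀ j : Fin m, (f y).1 j = q * (f x).1 j) ↔ n ≤ m := by
  constructor
  · rintro ⟨f, hf, hequiv⟩
    have h := finrank_le_of_odd_sphere_map (fun x => (f x).1) (continuous_subtype_val.comp hf)
      (fun x => ?_) (fun x => ne_zero_of_mem_unit_sphere (f x))
    · rw [finrank_quaternion_space, finrank_quaternion_space] at h
      omega
    · ext1 j
      simpa using hequiv (-1) (by simp) x (-x) (fun i => by simp) j
  · intro hnm
    let g : (PiLp 2 fun _ : Fin n => ℍ[ℝ]) → PiLp 2 fun _ : Fin m => ℍ[ℝ] := fun x =>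
      WithLp.toLp 2 fun j => if hj : (j : ℕ) < n then x ⟨j, hj⟩ else 0
    have hgc : Continuous g := by
      refine (PiLp.continuous_toLp 2 _).comp (continuous_pi fun j => ?_)
      split_ifs <;> fun_prop
    have hg : ∀ x, ‖g x‖ = ‖x‖ := by
      intro x
      rw [PiLp.norm_eq_of_L2, PiLp.norm_eq_of_L2]
      congr 1
      refine (Finset.sum_of_injOn (Fin.castLE hnm) (Fin.castLE_injective hnm).injOn (by simp)
        (fun j _ hj => ?_) (fun i _ => ?_)).symm
      · have : ¬ (j : ℕ) < n := fun h => hj ⟨⟨j, h⟩, by simp, by ext; simp⟩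
        simp [g, this]
      · simp [g]
    refine ⟨fun x => ⟨g x.1, by simp [hg]⟩, by fun_prop, ?_⟩
    intro q _ x y hxy j
    simp only [g]
    split_ifs with hj
    · exact hxy _
    · simp
end

section
/- Let n ≥ 3 with n ≡ 2 or 3 (mod 4). Then the fundamental group of the real projective Stiefel manifold ℝX_{n,n−1}, the quotient of the real Stiefel manifold V_{n,n−1} of orthonormal (n−1)-frames in ℝⁿ by the free ℤ/2-action sending a frame A to −A, is cyclic of order 4 (isomorphic to ℤ/4ℤ). -/
open Matrix

/-- The real Stiefel manifold `V_{n,k}` of orthonormal `k`-frames in `ℝⁿ`, realized as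
the space of `k × n` real matrices `A` with `A * Aᵀ = 1`, with the subspace topology from
the space of matrices. -/
abbrev RStiefel (n k : ℕ) : Type :=
  {A : Matrix (Fin k) (Fin n) ℝ // A * Aᵀ = 1}

/-- The real projective Stiefel manifold `ℝX_{n,k}`: the quotient topological space of
`V_{n,k}` by the free `ℤ/2`-action whose nontrivial element sends a frame `A` to `-A`. -/
abbrev RProjStiefel (n k : ℕ) : Type :=
  Quot (fun A B : RStiefel n k => B.1 = -A.1)

open unitInterval in
/-- A space covered by two simply connected open sets with path-connected intersection is simply
connected. -/
theorem simplyConnectedSpace_of_union {X : Type*} [TopologicalSpace X] {U V : Set X}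
    (hU : IsOpen U) (hV : IsOpen V) (hUV : U ∪ V = Set.univ) (sU : IsSimplyConnected U)
    (sV : IsSimplyConnected V) (hc : IsPathConnected (U ∩ V)) : SimplyConnectedSpace X := by
  have key : ∀ W : Set X, IsSimplyConnected W → ∀ {x y : X} (p q : Path x y),
      (∀ t, p t ∈ W) → (∀ t, q t ∈ W) →
      Path.Homotopic.Quotient.mk p = Path.Homotopic.Quotient.mk q := by
    intro W sW x y p q hp hq
    have := sW.simplyConnectedSpace
    let x' : W := ⟨x, by simpa using hp 0⟩
    let y' : W := ⟨y, by simpa using hp 1⟩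
    let p' : Path x' y' := ⟨⟨fun t ↦ ⟨p t, hp t⟩, by fun_prop⟩, by simp [x'], by simp [y']⟩
    let q' : Path x' y' := ⟨⟨fun t ↦ ⟨q t, hq t⟩, by fun_prop⟩, by simp [x'], by simp [y']⟩
    exact Quotient.sound
      ((SimplyConnectedSpace.paths_homotopic p' q').map ⟨Subtype.val, continuous_subtype_val⟩)
  obtain ⟨x₀, hx₀⟩ := hc.nonempty
  have hex : ∀ y, ∃ c : Path.Homotopic.Quotient x₀ y,
      (∀ δ : Path x₀ y, (∀ t, δ t ∈ U) → Path.Homotopic.Quotient.mk δ = c) ∧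
      (∀ δ : Path x₀ y, (∀ t, δ t ∈ V) → Path.Homotopic.Quotient.mk δ = c) := by
    intro y
    have hy : y ∈ U ∪ V := hUV ▸ Set.mem_univ y
    by_cases hyU : y ∈ U <;> by_cases hyV : y ∈ V
    · obtain ⟨η, hη⟩ := hc.joinedIn x₀ hx₀ y ⟨hyU, hyV⟩
      exact ⟨.mk η, fun δ hδ ↦ key U sU _ _ hδ fun t ↦ (hη t).1,
        fun δ hδ ↦ key V sV _ _ hδ fun t ↦ (hη t).2⟩
    · obtain ⟨η, hη⟩ := sU.isPathConnected.joinedIn x₀ hx₀.1 y hyU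
      exact ⟨.mk η, fun δ hδ ↦ key U sU _ _ hδ hη,
        fun δ hδ ↦ absurd (by simpa using hδ 1) hyV⟩
    · obtain ⟨η, hη⟩ := sV.isPathConnected.joinedIn x₀ hx₀.2 y hyV
      exact ⟨.mk η, fun δ hδ ↦ absurd (by simpa using hδ 1) hyU,
        fun δ hδ ↦ key V sV _ _ hδ hη⟩
    · exact absurd hy (by simp [hyU, hyV])
  choose c hcU hcV using hex
  have seg : ∀ W : Set X, IsSimplyConnected W → x₀ ∈ W →
      (∀ (y) (δ : Path x₀ y), (∀ t, δ t ∈ W) → Path.Homotopic.Quotient.mk δ = c y) →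
      ∀ {y z : X} (δ : Path y z), (∀ t, δ t ∈ W) → (c y).trans (.mk δ) = c z := by
    intro W sW hx hW y z δ hδ
    obtain ⟨η, hη⟩ := sW.isPathConnected.joinedIn x₀ hx y (by simpa using hδ 0)
    rw [← hW y η hη, ← hW z (η.trans δ), Path.Homotopic.Quotient.mk_trans]
    intro t
    have : (η.trans δ) t ∈ Set.range (η.trans δ) := ⟨t, rfl⟩
    rw [Path.trans_range] at this
    rcases this with ⟨s, hs⟩ | ⟨s, hs⟩
    · exact hs ▸ hη s
    · exact hs ▸ hδ s
  have main : ∀ {a b : X} (γ : Path a b), (c a).trans (.mk γ) = c b := by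
    intro a b γ
    obtain ⟨t, t0, tmono, ⟨m, hm⟩, hcov⟩ := exists_monotone_Icc_subset_open_cover_unitInterval
      (c := fun i : Bool ↦ γ ⁻¹' (if i then U else V))
      (fun i ↦ by cases i <;> simp <;> apply IsOpen.preimage γ.continuous <;> assumption)
      (fun s _ ↦ by
        have hy : γ s ∈ U ∪ V := hUV ▸ Set.mem_univ _
        simpa [Set.mem_iUnion, or_comm] using hy)
    have step : ∀ k, (c (γ 0)).trans (.mk (γ.subpath 0 (t k))) = c (γ (t k)) := by
      intro k
      induction k with
      | zero =>
        rw [t0, Path.subpath_self]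
        simp
      | succ k ih =>
        have h1 : Path.Homotopic.Quotient.mk (γ.subpath 0 (t (k + 1))) =
            (Path.Homotopic.Quotient.mk (γ.subpath 0 (t k))).trans
              (.mk (γ.subpath (t k) (t (k + 1)))) := by
          rw [← Path.Homotopic.Quotient.mk_trans]
          exact (Path.Homotopic.Quotient.eq.mpr
            ⟨Path.Homotopy.subpathTransSubpath γ _ _ _⟩).symm
        have hr : ∀ s, (γ.subpath (t k) (t (k + 1))) s ∈ γ '' Set.Icc (t k) (t (k + 1)) := by
          intro s
          rw [← Path.range_subpath_of_le _ _ _ (tmono k.le_succ)]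
          exact ⟨s, rfl⟩
        rw [h1, ← Path.Homotopic.Quotient.trans_assoc, ih]
        obtain ⟨i, hi⟩ := hcov k
        cases i
        · refine seg V sV hx₀.2 hcV _ fun s ↦ ?_
          obtain ⟨r, hr, h⟩ := hr s
          simpa [h] using hi hr
        · refine seg U sU hx₀.1 hcU _ fun s ↦ ?_
          obtain ⟨r, hr, h⟩ := hr s
          simpa [h] using hi hr
    have h1 := step m
    rw [hm m le_rfl] at h1
    have e : ∀ {a' b' : X} (ha : a' = a) (hb : b' = b) (γ' : Path a' b'),
        γ' = γ.cast ha hb → (c a').trans (.mk γ') = c b' → (c a).trans (.mk γ) = c b := by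
      rintro _ _ rfl rfl γ' rfl h
      exact h
    exact e γ.source γ.target _ (Path.subpath_zero_one γ) h1
  refine simply_connected_iff_paths_homotopic.mpr ⟨?_, fun x y ↦ ⟨fun p q ↦ ?_⟩⟩
  · exact ⟨⟨x₀⟩, fun x y ↦ by
      obtain ⟨p⟩ := Quotient.exists_rep (c x) |>.imp fun _ _ ↦ trivial
      obtain ⟨q⟩ := Quotient.exists_rep (c y) |>.imp fun _ _ ↦ trivial
      exact ⟨p.symm.trans q⟩⟩
  · induction p using Quotient.inductionOn with | _ p
    induction q using Quotient.inductionOn with | _ q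
    have h := (main p).trans (main q).symm
    have h2 := congrArg (fun r ↦ (c x).symm.trans r) h
    simpa [← Path.Homotopic.Quotient.trans_assoc] using h2

theorem isPathConnected_unit_vectors_ne_ne_neg {F : Type*} [NormedAddCommGroup F]
    [InnerProductSpace ℝ F] (hF : 2 < Module.rank ℝ F) {e : F} (he : ‖e‖ = 1) :
    IsPathConnected {x : F | ‖x‖ = 1 ∧ x ≠ e ∧ x ≠ -e} := by
  have hcod : 1 < Module.rank ℝ (F ⧸ Submodule.span ℝ {e}) := by
    by_contra! h
    have h1 := rank_span_le (R := ℝ) ({e} : Set F)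
    rw [Cardinal.mk_singleton] at h1
    have h2 := Submodule.rank_quotient_add_rank (Submodule.span ℝ {e})
    have h3 := add_le_add h h1
    rw [h2, one_add_one_eq_two] at h3
    exact absurd hF (not_lt.mpr h3)
  have hpc := isPathConnected_compl_of_one_lt_codim hcod
  have hne : ∀ x ∈ ((Submodule.span ℝ {e} : Submodule ℝ F) : Set F)ᶜ, x ≠ 0 := by
    rintro x hx rfl
    exact hx (Submodule.zero_mem _)
  have hcont : ContinuousOn (fun x : F ↦ ‖x‖⁻¹ • x)
      ((Submodule.span ℝ {e} : Submodule ℝ F) : Set F)ᶜ :=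
    (continuousOn_id.norm.inv₀ fun x hx ↦ norm_ne_zero_iff.mpr (hne x hx)).smul continuousOn_id
  convert hpc.image' hcont using 1
  ext x
  constructor
  · rintro ⟨hx, h1, h2⟩
    refine ⟨x, fun hmem ↦ ?_, by simp [hx]⟩
    obtain ⟨c, rfl⟩ := Submodule.mem_span_singleton.mp hmem
    rw [norm_smul, he, mul_one, Real.norm_eq_abs] at hx
    rcases eq_or_eq_neg_of_abs_eq hx with rfl | rfl
    · exact h1 (one_smul _ _)
    · exact h2 (by simp)
  · rintro ⟨y, hy, rfl⟩
    have hn : ‖y‖ ≠ 0 := norm_ne_zero_iff.mpr (hne y hy)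
    have aux : ∀ c : ℝ, ‖y‖⁻¹ • y ≠ c • e := fun c hc ↦ hy <| Submodule.mem_span_singleton.mpr
      ⟨‖y‖ * c, by rw [mul_smul, ← hc, smul_inv_smul₀ hn]⟩
    refine ⟨by simp [norm_smul, hn], ?_, ?_⟩
    · simpa using aux 1
    · simpa using aux (-1)

theorem isSimplyConnected_sphere_compl_singleton {F : Type*} [NormedAddCommGroup F]
    [InnerProductSpace ℝ F] (v : Metric.sphere (0 : F) 1) :
    IsSimplyConnected ({v}ᶜ : Set (Metric.sphere (0 : F) 1)) := by
  have hv : ‖(v : F)‖ = 1 := by simp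
  let φ := stereographic hv
  have h : φ.source ≃ₜ (ℝ ∙ (v : F))ᗮ :=
    φ.toHomeomorphSourceTarget.trans
      ((Homeomorph.setCongr (stereographic_target hv)).trans (Homeomorph.Set.univ _))
  exact (h.trans (Homeomorph.refl _)).toHomotopyEquiv.simplyConnectedSpace

theorem simplyConnectedSpace_sphere {F : Type*} [NormedAddCommGroup F]
    [InnerProductSpace ℝ F] (hF : 2 < Module.rank ℝ F) :
    SimplyConnectedSpace (Metric.sphere (0 : F) 1) := by
  have : Nontrivial F := rank_pos_iff_nontrivial.mp (lt_trans two_pos hF)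
  obtain ⟨e⟩ : Nonempty (Metric.sphere (0 : F) 1) :=
    (NormedSpace.sphere_nonempty.mpr zero_le_one).to_subtype
  refine simplyConnectedSpace_of_union (U := {e}ᶜ) (V := {-e}ᶜ) isOpen_compl_singleton
    isOpen_compl_singleton ?_ (isSimplyConnected_sphere_compl_singleton e)
    (isSimplyConnected_sphere_compl_singleton (-e)) ?_
  · have hne : e ≠ -e := ne_neg_of_mem_unit_sphere ℝ e
    rw [← Set.compl_inter, Set.compl_univ_iff.mpr]
    ext x
    simp only [Set.mem_inter_iff, Set.mem_singleton_iff, Set.mem_empty_iff_false, iff_false]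
    rintro ⟨rfl, h⟩
    exact hne h
  · rw [Topology.IsInducing.subtypeVal.isPathConnected_iff]
    convert isPathConnected_unit_vectors_ne_ne_neg hF (e := (e : F)) (by simp) using 1
    ext x
    simp [and_assoc]
    tauto

/-- A family of self-adjoint square roots of `1` that anticommute pairwise: generators of a
representation of the Clifford algebra of a positive definite quadratic form. -/
structure IsCliffordFamily {κ M : Type*} [Ring M] [StarRing M] (γ : κ → M) : Prop where
  star_eq (i : κ) : star (γ i) = γ i
  mul_self (i : κ) : γ i * γ i = 1
  anticomm {i j : κ} (h : i ≠ j) : γ i * γ j = -(γ j * γ i)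

theorem exists_isCliffordFamily (n : ℕ) :
    ∃ (N : ℕ) (_ : 0 < N) (γ : Fin n → Matrix (Fin N) (Fin N) ℝ), IsCliffordFamily γ := by
  suffices h : ∃ (ι : Type) (_ : Fintype ι) (_ : DecidableEq ι) (_ : Nonempty ι)
      (γ : Fin n → Matrix ι ι ℝ), IsCliffordFamily γ by
    obtain ⟨ι, _, _, _, γ, hγ⟩ := h
    let e := Matrix.reindexAlgEquiv ℝ ℝ (Fintype.equivFin ι)
    refine ⟨Fintype.card ι, Fintype.card_pos, fun i ↦ e (γ i), fun i ↦ ?_, fun i ↦ ?_, fun h ↦ ?_⟩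
    · rw [Matrix.star_eq_conjTranspose, Matrix.coe_reindexAlgEquiv, Matrix.conjTranspose_reindex,
        ← Matrix.star_eq_conjTranspose, hγ.star_eq]
    · rw [← map_mul, hγ.mul_self, map_one]
    · rw [← map_mul, ← map_mul, ← map_neg, hγ.anticomm h]
  induction n with
  | zero =>
    exact ⟨Unit, inferInstance, inferInstance, inferInstance, Fin.elim0, fun i ↦ i.elim0,
      fun i ↦ i.elim0, fun {i} ↦ i.elim0⟩
  | succ n ih =>
    obtain ⟨ι, _, _, _, γ, hγ⟩ := ih
    refine ⟨ι ⊕ ι, inferInstance, inferInstance, inferInstance,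
      Fin.cons (Matrix.fromBlocks 0 1 1 0) fun i ↦ Matrix.fromBlocks (γ i) 0 0 (-γ i),
      fun i ↦ ?_, fun i ↦ ?_, fun {i j} h ↦ ?_⟩
    · refine Fin.cases ?_ (fun i ↦ ?_) i
      · simp [Matrix.star_eq_conjTranspose, Matrix.fromBlocks_transpose]
      · have : (γ i)ᵀ = γ i := by simpa [Matrix.star_eq_conjTranspose] using hγ.star_eq i
        simp [Matrix.star_eq_conjTranspose, Matrix.fromBlocks_transpose, this]
    · refine Fin.cases ?_ (fun i ↦ ?_) i <;>
        simp [Matrix.fromBlocks_multiply, hγ.mul_self]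
    · induction i using Fin.cases <;> induction j using Fin.cases
      · exact absurd rfl h
      · simp [Matrix.fromBlocks_multiply, Matrix.fromBlocks_neg]
      · simp [Matrix.fromBlocks_multiply, Matrix.fromBlocks_neg]
      · have := hγ.anticomm (fun hij ↦ h (congrArg Fin.succ hij))
        simp [Matrix.fromBlocks_multiply, Matrix.fromBlocks_neg, this]

namespace CliffordFamily

section Algebra

variable {κ M : Type*} [Ring M] [Algebra ℝ M]

/-- The subalgebra generated by the products of two members of `γ` with indices in `J`. -/
def evenSubalgebra (γ : κ → M) (J : Set κ) : Subalgebra ℝ M :=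
  Algebra.adjoin ℝ {x | ∃ i ∈ J, ∃ j ∈ J, x = γ i * γ j}

variable {γ : κ → M} {J : Set κ}

theorem mul_mem_evenSubalgebra {i j : κ} (hi : i ∈ J) (hj : j ∈ J) :
    γ i * γ j ∈ evenSubalgebra γ J :=
  Algebra.subset_adjoin ⟨i, hi, j, hj, rfl⟩

variable [StarRing M]

theorem conj_mem_evenSubalgebra (hγ : IsCliffordFamily γ) {b : κ} (hb : b ∈ J) {x : M}
    (hx : x ∈ evenSubalgebra γ J) : γ b * x * γ b ∈ evenSubalgebra γ J := by
  induction hx using Algebra.adjoin_induction with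
  | mem x hx =>
    obtain ⟨i, hi, j, hj, rfl⟩ := hx
    rw [← mul_assoc, mul_assoc _ (γ j)]
    exact mul_mem (mul_mem_evenSubalgebra hb hi) (mul_mem_evenSubalgebra hj hb)
  | algebraMap r =>
    rw [← Algebra.commutes, mul_assoc, hγ.mul_self, mul_one]
    exact Subalgebra.algebraMap_mem _ _
  | add x y _ _ hx hy =>
    rw [mul_add, add_mul]
    exact add_mem hx hy
  | mul x y _ _ hx hy =>
    have : γ b * (x * y) * γ b = γ b * x * γ b * (γ b * y * γ b) := by
      rw [← mul_assoc (γ b * x * γ b), ← mul_assoc (γ b * x * γ b), mul_assoc (γ b * x) (γ b),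
        hγ.mul_self, mul_one]
      simp only [mul_assoc]
    rw [this]
    exact mul_mem hx hy

theorem commute_of_mem_evenSubalgebra (hγ : IsCliffordFamily γ) {a : κ} (ha : a ∉ J) {x : M}
    (hx : x ∈ evenSubalgebra γ J) : Commute (γ a) x := by
  induction hx using Algebra.adjoin_induction with
  | mem x hx =>
    obtain ⟨i, hi, j, hj, rfl⟩ := hx
    have hai : a ≠ i := fun h ↦ ha (h ▸ hi)
    have haj : a ≠ j := fun h ↦ ha (h ▸ hj)
    rw [commute_iff_eq, ← mul_assoc, hγ.anticomm hai, neg_mul, mul_assoc, hγ.anticomm haj]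
    simp [mul_assoc]
  | algebraMap r => exact (Algebra.commutes r _).symm
  | add x y _ _ hx hy => exact hx.add_right hy
  | mul x y _ _ hx hy => exact hx.mul_right hy

theorem exists_eq_add_of_mem_evenSubalgebra_insert (hγ : IsCliffordFamily γ) {a b : κ}
    (ha : a ∉ J) (hb : b ∈ J) {x : M} (hx : x ∈ evenSubalgebra γ (insert a J)) :
    ∃ α ∈ evenSubalgebra γ J, ∃ β ∈ evenSubalgebra γ J, x = α + β * (γ b * γ a) := by
  have hab : a ≠ b := fun h ↦ ha (h ▸ hb)
  induction hx using Algebra.adjoin_induction with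
  | mem x hx =>
    obtain ⟨i, hi, j, hj, rfl⟩ := hx
    rcases hi with rfl | hi <;> rcases hj with rfl | hj
    · exact ⟨1, one_mem _, 0, zero_mem _, by simp [hγ.mul_self]⟩
    · have hij : i ≠ j := fun h ↦ ha (h ▸ hj)
      refine ⟨0, zero_mem _, -(γ j * γ b), neg_mem (mul_mem_evenSubalgebra hj hb), ?_⟩
      rw [hγ.anticomm hij, zero_add, neg_mul, mul_assoc, ← mul_assoc (γ b),
        hγ.mul_self, one_mul]
    · refine ⟨0, zero_mem _, γ i * γ b, mul_mem_evenSubalgebra hi hb, ?_⟩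
      rw [zero_add, mul_assoc, ← mul_assoc (γ b), hγ.mul_self, one_mul]
    · exact ⟨_, mul_mem_evenSubalgebra hi hj, 0, zero_mem _, by simp⟩
  | algebraMap r => exact ⟨_, Subalgebra.algebraMap_mem _ r, 0, zero_mem _, by simp⟩
  | add x y _ _ hx hy =>
    obtain ⟨α, hα, β, hβ, rfl⟩ := hx
    obtain ⟨α', hα', β', hβ', rfl⟩ := hy
    exact ⟨_, add_mem hα hα', _, add_mem hβ hβ', by rw [add_mul]; abel⟩
  | mul x y _ _ hx hy =>
    obtain ⟨α, hα, β, hβ, rfl⟩ := hx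
    obtain ⟨α', hα', β', hβ', rfl⟩ := hy
    have key : ∀ z ∈ evenSubalgebra γ J, γ b * γ a * z = γ b * z * γ b * (γ b * γ a) := by
      intro z hz
      rw [mul_assoc, (commute_of_mem_evenSubalgebra hγ ha hz).eq, mul_assoc _ (γ b) (γ b * γ a),
        ← mul_assoc (γ b) (γ b), hγ.mul_self, one_mul, mul_assoc]
    have sq : γ b * γ a * (γ b * γ a) = -1 := by
      rw [mul_assoc, ← mul_assoc (γ a), hγ.anticomm hab, neg_mul, mul_assoc (γ b), hγ.mul_self,
        mul_one, mul_neg, hγ.mul_self]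
    refine ⟨α * α' - β * (γ b * β' * γ b),
      sub_mem (mul_mem hα hα') (mul_mem hβ (conj_mem_evenSubalgebra hγ hb hβ')),
      α * β' + β * (γ b * α' * γ b),
      add_mem (mul_mem hα hβ') (mul_mem hβ (conj_mem_evenSubalgebra hγ hb hα')), ?_⟩
    have e1 : β * (γ b * γ a) * α' = β * (γ b * α' * γ b) * (γ b * γ a) := by
      rw [mul_assoc, key α' hα', ← mul_assoc]
    have e2 : β * (γ b * γ a) * (β' * (γ b * γ a)) = -(β * (γ b * β' * γ b)) := by
      rw [← mul_assoc, mul_assoc β, key β' hβ', mul_assoc, mul_assoc _ (γ b * γ a), sq]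
      simp
    rw [add_mul, mul_add, mul_add, e1, e2, add_mul, mul_assoc α β']
    abel

theorem mem_evenSubalgebra_of_commute (hγ : IsCliffordFamily γ) {a b : κ}
    (ha : a ∉ J) (hb : b ∈ J) {x : M} (hx : x ∈ evenSubalgebra γ (insert a J))
    (hc : x * γ a = γ a * x) : x ∈ evenSubalgebra γ J := by
  obtain ⟨α, hα, β, hβ, rfl⟩ := exists_eq_add_of_mem_evenSubalgebra_insert hγ ha hb hx
  have hab : a ≠ b := fun h ↦ ha (h ▸ hb)
  have e1 : β * (γ b * γ a) * γ a = β * γ b := by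
    rw [mul_assoc, mul_assoc, hγ.mul_self, mul_one]
  have e2 : γ a * (β * (γ b * γ a)) = -(β * γ b) := by
    rw [← mul_assoc, (commute_of_mem_evenSubalgebra hγ ha hβ).eq, mul_assoc, ← mul_assoc (γ a),
      hγ.anticomm hab, neg_mul, mul_assoc, hγ.mul_self, mul_one, mul_neg]
  rw [add_mul, mul_add, (commute_of_mem_evenSubalgebra hγ ha hα).eq, e1, e2,
    add_right_inj, eq_neg_iff_add_eq_zero, ← two_smul ℝ, smul_eq_zero_iff_right two_ne_zero] at hc
  rwa [← mul_assoc, hc, zero_mul, add_zero]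

theorem exists_of_mem_evenSubalgebra_singleton (hγ : IsCliffordFamily γ) {a : κ} {x : M}
    (hx : x ∈ evenSubalgebra γ {a}) : ∃ r : ℝ, x = r • (1 : M) := by
  have : x ∈ (⊥ : Subalgebra ℝ M) := by
    refine Algebra.adjoin_le ?_ hx
    rintro _ ⟨i, rfl, j, rfl, rfl⟩
    rw [hγ.mul_self]
    exact one_mem _
  obtain ⟨r, rfl⟩ := Algebra.mem_bot.mp this
  exact ⟨r, Algebra.algebraMap_eq_smul_one r⟩

theorem exists_of_mem_evenSubalgebra_triple (hγ : IsCliffordFamily γ) {a b c : κ}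
    (hab : a ≠ b) (hac : a ≠ c) (hbc : b ≠ c) {x : M} (hx : x ∈ evenSubalgebra γ {a, b, c}) :
    ∃ q : Fin 4 → ℝ, x = q 0 • (1 : M) + q 1 • (γ c * γ b) + q 2 • (γ b * γ a) +
      q 3 • (γ c * γ a) := by
  have pair : ∀ y ∈ evenSubalgebra γ {b, c}, ∃ s t : ℝ, y = s • (1 : M) + t • (γ c * γ b) := by
    intro y hy
    obtain ⟨α, hα, β, hβ, rfl⟩ := exists_eq_add_of_mem_evenSubalgebra_insert hγ
      (a := b) (b := c) (by simpa using hbc) (Set.mem_singleton c) hy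
    obtain ⟨s, rfl⟩ := exists_of_mem_evenSubalgebra_singleton hγ hα
    obtain ⟨t, rfl⟩ := exists_of_mem_evenSubalgebra_singleton hγ hβ
    exact ⟨s, t, by simp⟩
  obtain ⟨α, hα, β, hβ, rfl⟩ := exists_eq_add_of_mem_evenSubalgebra_insert hγ
    (a := a) (b := b) (by simp [hab, hac]) (by simp) hx
  obtain ⟨s, t, rfl⟩ := pair α hα
  obtain ⟨s', t', rfl⟩ := pair β hβ
  refine ⟨![s, t, s', t'], ?_⟩
  have e : γ c * γ b * (γ b * γ a) = γ c * γ a := by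
    rw [mul_assoc, ← mul_assoc (γ b), hγ.mul_self, one_mul]
  simp [add_mul, e, add_assoc]

end Algebra

end CliffordFamily

/-- The half-turn about the line bisecting two unit vectors exchanges them. -/
theorem half_turn_normalize_add {F : Type*} [NormedAddCommGroup F] [InnerProductSpace ℝ F]
    {e x : F} (he : ‖e‖ = 1) (hx : ‖x‖ = 1) (hxe : x ≠ -e) :
    (2 * inner ℝ (‖e + x‖⁻¹ • (e + x)) e : ℝ) • (‖e + x‖⁻¹ • (e + x)) - e = x := by
  have hn : ‖e + x‖ ≠ 0 := by
    rw [norm_ne_zero_iff, add_comm]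
    exact fun h ↦ hxe (eq_neg_of_add_eq_zero_left h)
  have hsq : ‖e + x‖ ^ 2 = 2 * (1 + inner ℝ x e) := by
    rw [norm_add_sq_real, he, hx, real_inner_comm]
    ring
  rw [inner_smul_left, inner_add_left, real_inner_self_eq_norm_sq, he, smul_smul,
    RCLike.conj_to_real]
  have : 2 * (‖e + x‖⁻¹ * (1 ^ 2 + inner ℝ x e)) * ‖e + x‖⁻¹ = 1 := by
    field_simp
    rw [hsq]
  rw [this, one_smul, add_sub_cancel_left]

open unitInterval in
/-- A topological group that acts on a Euclidean space preserving the unit sphere, with a continuous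
family of elements `ρ u` that act on a unit vector `e` as the half-turns about the lines `ℝ u`, is
simply connected as soon as the stabilizer of `e` is. -/
theorem simplyConnectedSpace_of_stabilizer {F : Type*} [NormedAddCommGroup F]
    [InnerProductSpace ℝ F] (hF : 2 < Module.rank ℝ F) {G : Type*} [Group G] [TopologicalSpace G]
    [IsTopologicalGroup G] (act : G →* Module.End ℝ F) {e : F} (he : ‖e‖ = 1)
    (hnorm : ∀ g, ‖act g e‖ = 1) (hact : Continuous fun g ↦ act g e)
    (ρ : Metric.sphere (0 : F) 1 → G) (hρ : Continuous ρ)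
    (hρe : ∀ u : Metric.sphere (0 : F) 1, (u : F) = e → ρ u = 1)
    (hρact : ∀ u, act (ρ u) e = (2 * inner ℝ (u : F) e) • (u : F) - e)
    (H : Subgroup G) (hH : ∀ g, g ∈ H ↔ act g e = e) [SimplyConnectedSpace H] :
    SimplyConnectedSpace G := by
  have he0 : inner ℝ e e = (1 : ℝ) := by rw [real_inner_self_eq_norm_sq, he, one_pow]
  have hcancel : ∀ {g x y}, act g x = y → act g⁻¹ y = x := by
    rintro g x y rfl
    rw [← Module.End.mul_apply, ← map_mul, inv_mul_cancel, map_one, Module.End.one_apply]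
  have hee : e ≠ -e := by
    intro h
    rw [eq_neg_iff_add_eq_zero, ← two_smul ℝ, smul_eq_zero_iff_right two_ne_zero] at h
    simp [h] at he
  let w : ℝ → F → F := fun t x ↦ ‖e + t • x‖⁻¹ • (e + t • x)
  have hne : ∀ t ∈ I, ∀ x : F, ‖x‖ = 1 → x ≠ -e → e + t • x ≠ 0 := by
    rintro t ⟨ht, -⟩ x hx hxe h
    have h1 : e = -(t • x) := eq_neg_of_add_eq_zero_left h
    have h2 : t = 1 := by
      have := congrArg norm h1
      rw [he, norm_neg, norm_smul, hx, mul_one, Real.norm_of_nonneg ht] at this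
      exact this.symm
    rw [h2, one_smul] at h1
    exact hxe (by rw [h1, neg_neg])
  have hw : ∀ t ∈ I, ∀ x : F, ‖x‖ = 1 → x ≠ -e → w t x ∈ Metric.sphere (0 : F) 1 := by
    intro t ht x hx hxe
    rw [mem_sphere_zero_iff_norm]
    exact norm_smul_inv_norm (𝕜 := ℝ) (hne t ht x hx hxe)
  have hcw : ContinuousOn (fun p : ℝ × F ↦ w p.1 p.2) {p | p.1 ∈ I ∧ ‖p.2‖ = 1 ∧ p.2 ≠ -e} := by
    refine ContinuousOn.smul (ContinuousOn.inv₀ (by fun_prop) ?_) (by fun_prop)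
    rintro ⟨t, x⟩ ⟨ht, hx, hxe⟩
    exact norm_ne_zero_iff.mpr (hne t ht x hx hxe)
  have hw1 : ∀ x : F, ∀ hx : ‖x‖ = 1, ∀ hxe : x ≠ -e,
      act (ρ ⟨w 1 x, hw 1 ⟨zero_le_one, le_rfl⟩ x hx hxe⟩) e = x := by
    intro x hx hxe
    rw [hρact]
    simpa [w] using half_turn_normalize_add he hx hxe
  let U : Set G := {g | act g e ≠ -e}
  let V : Set G := {g | act g e ≠ e}
  have hU : IsOpen U := isOpen_ne_fun hact continuous_const
  have hV : IsOpen V := isOpen_ne_fun hact continuous_const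
  let K : I × U → G := fun p ↦
    (ρ ⟨w p.1 (act (p.2 : G) e), hw _ p.1.2 _ (hnorm _) p.2.2⟩)⁻¹ * p.2
  have hK : Continuous K := by
    refine Continuous.mul (hρ.comp (Continuous.subtype_mk ?_ _)).inv (by fun_prop)
    refine hcw.comp_continuous (f := fun p : I × U ↦ ((p.1 : ℝ), act (p.2 : G) e)) ?_ ?_
    · exact Continuous.prodMk (by fun_prop) (hact.comp (by fun_prop))
    · exact fun p ↦ ⟨p.1.2, hnorm _, p.2.2⟩
  have hKU : ∀ p, K p ∈ U := by
    rintro ⟨t, g, hg⟩ h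
    have hwt := hw t t.2 _ (hnorm g) hg
    have hw' : ‖w t (act g e)‖ = 1 := by simpa using hwt
    have h1 : act g e = -((2 * inner ℝ (w t (act g e)) e) • (w t (act g e)) - e) := by
      have : act (ρ ⟨w t (act g e), hwt⟩ * K (t, ⟨g, hg⟩)) e =
          act (ρ ⟨w t (act g e), hwt⟩) (-e) := by
        rw [map_mul, Module.End.mul_apply, h]
      rw [map_neg, hρact] at this
      rw [← this]
      simp [K]
    have h2 : inner ℝ (act g e + e) (w t (act g e)) = (0 : ℝ) := by
      have h3 := congrArg (inner ℝ (w t (act g e))) h1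
      rw [inner_neg_right, inner_sub_right, inner_smul_right, real_inner_self_eq_norm_sq, hw'] at h3
      rw [inner_add_left, real_inner_comm, real_inner_comm _ e, h3]
      ring
    have hn := hne t t.2 _ (hnorm g) hg
    rw [inner_smul_right, mul_eq_zero, or_iff_right (inv_ne_zero (norm_ne_zero_iff.mpr hn)),
      inner_add_left, inner_add_right, inner_add_right, inner_smul_right, inner_smul_right,
      real_inner_self_eq_norm_sq, hnorm, he0, real_inner_comm] at h2
    have h4 : (1 + inner ℝ e (act g e)) * (1 + (t : ℝ)) = 0 := by linarith
    have h5 : (1 + (t : ℝ)) ≠ 0 := by have := t.2.1; positivity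
    have h6 : ‖act g e + e‖ ^ 2 = 0 := by
      rw [norm_add_sq_real, hnorm, he, real_inner_comm]
      have := (mul_eq_zero.mp h4).resolve_right h5
      linarith
    exact hg (eq_neg_of_add_eq_zero_left (norm_eq_zero.mp (pow_eq_zero_iff two_ne_zero |>.mp h6)))
  have hK1 : ∀ g : U, K (1, g) ∈ H := by
    rintro ⟨g, hg⟩
    rw [hH]
    simp only [K, map_mul, Module.End.mul_apply]
    exact hcancel (hw1 _ (hnorm g) hg)
  have hK0 : ∀ g : U, K (0, g) = g := by
    rintro ⟨g, hg⟩
    refine (congrArg (fun a ↦ a⁻¹ * g) (hρe _ (by simp [w, he]))).trans ?_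
    rw [inv_one, one_mul]
  have hHU : ∀ h ∈ H, h ∈ U := by
    intro h hh h'
    exact hee (by rw [← h', (hH h).mp hh])
  have hKH : ∀ h : G, ∀ hh : h ∈ H, K (1, ⟨h, hHU h hh⟩) = h := by
    intro h hh
    refine (congrArg (fun a ↦ a⁻¹ * h) (hρe _ ?_)).trans (by rw [inv_one, one_mul])
    simp only [w, (hH h).mp hh, Set.Icc.coe_one, one_smul, ← two_smul ℝ e, norm_smul, he]
    simp
  let φ : C(I × U, U) := ⟨fun p ↦ ⟨K p, hKU p⟩, by fun_prop⟩
  let incl : C(H, U) := ⟨fun h ↦ ⟨h, hHU h h.2⟩, by fun_prop⟩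
  let r : C(U, H) := ⟨fun g ↦ ⟨K (1, g), hK1 g⟩, by fun_prop⟩
  have eq : ContinuousMap.HomotopyEquiv U H :=
    { toFun := r
      invFun := incl
      left_inv := ⟨(⟨φ, fun g ↦ Subtype.ext (hK0 g), fun g ↦ rfl⟩ :
        ContinuousMap.Homotopy (ContinuousMap.id U) (incl.comp r)).symm⟩
      right_inv := by
        have : r.comp incl = ContinuousMap.id H := by
          ext h
          exact hKH h h.2
        rw [this] }
  have sU : IsSimplyConnected U := eq.simplyConnectedSpace
  have hpc := isPathConnected_unit_vectors_ne_ne_neg hF he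
  obtain ⟨g₀, hg₀⟩ : ∃ g, act g e = -e := by
    obtain ⟨x, hx, hxe, hxe'⟩ := hpc.nonempty
    let v := x - (inner ℝ x e : ℝ) • e
    have hv : v ≠ 0 := by
      intro h
      have h1 : x = (inner ℝ x e : ℝ) • e := sub_eq_zero.mp h
      have h2 := congrArg norm h1
      rw [norm_smul, he, mul_one, hx, Real.norm_eq_abs, eq_comm, abs_eq zero_le_one] at h2
      rcases h2 with h2 | h2 <;> rw [h2] at h1
      · exact hxe (by rw [h1, one_smul])
      · exact hxe' (by rw [h1, neg_one_smul])
    have hve : inner ℝ v e = (0 : ℝ) := by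
      simp [v, inner_sub_left, inner_smul_left, he]
    refine ⟨ρ ⟨‖v‖⁻¹ • v, mem_sphere_zero_iff_norm.mpr (norm_smul_inv_norm (𝕜 := ℝ) hv)⟩, ?_⟩
    rw [hρact]
    simp [inner_smul_left, hve]
  have sV : IsSimplyConnected V := by
    have : V = (fun g ↦ g₀⁻¹ * g) ⁻¹' U := by
      ext g
      simp only [U, V, Set.mem_preimage, Set.mem_ofPred_eq, map_mul, Module.End.mul_apply]
      refine not_congr ⟨fun h ↦ ?_, fun h ↦ ?_⟩
      · rw [h]
        exact hcancel (by rw [map_neg, hg₀, neg_neg])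
      · have := hcancel h
        rw [inv_inv, map_neg, hg₀, neg_neg] at this
        exact this.symm
    rw [this]
    exact (Homeomorph.mulLeft g₀⁻¹).isSimplyConnected_preimage.mpr sU
  refine simplyConnectedSpace_of_union hU hV ?_ sU sV ?_
  · ext g
    simp only [U, V, Set.mem_union, Set.mem_ofPred_eq, Set.mem_univ, iff_true]
    by_contra! h
    exact hee (h.2.symm.trans h.1)
  · let T : Set F := {x | ‖x‖ = 1 ∧ x ≠ e ∧ x ≠ -e}
    have : PathConnectedSpace T := isPathConnected_iff_pathConnectedSpace.mp hpc
    let f : T × H → G := fun p ↦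
      ρ ⟨w 1 (p.1 : F), hw 1 ⟨zero_le_one, le_rfl⟩ _ p.1.2.1 p.1.2.2.2⟩ * p.2
    have hf : Continuous f := by
      refine Continuous.mul (hρ.comp (Continuous.subtype_mk ?_ _)) (by fun_prop)
      refine hcw.comp_continuous (f := fun p : T × H ↦ ((1 : ℝ), (p.1 : F))) (by fun_prop) ?_
      exact fun p ↦ ⟨⟨zero_le_one, le_rfl⟩, p.1.2.1, p.1.2.2.2⟩
    have hfact : ∀ p, act (f p) e = p.1 := by
      intro p
      simp only [f, map_mul, Module.End.mul_apply]
      rw [(hH _).mp p.2.2, hw1 _ p.1.2.1 p.1.2.2.2]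
    have : U ∩ V = Set.range f := by
      ext g
      constructor
      · rintro ⟨hgU, hgV⟩
        refine ⟨(⟨act g e, hnorm g, hgV, hgU⟩, ⟨K (1, ⟨g, hgU⟩), hK1 _⟩), ?_⟩
        simp [f, K]
      · rintro ⟨p, rfl⟩
        refine ⟨?_, ?_⟩ <;> simp only [U, V, Set.mem_ofPred_eq, hfact]
        · exact p.1.2.2.2
        · exact p.1.2.2.1
    rw [this]
    exact isPathConnected_range hf

namespace CliffordFamily

section Vectors

variable {n : ℕ} {M : Type*} [Ring M] [Algebra ℝ M]

/-- The linear map sending the standard basis of Euclidean space to the family `γ`. -/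
noncomputable def vec (γ : Fin n → M) : EuclideanSpace ℝ (Fin n) →ₗ[ℝ] M :=
  Fintype.linearCombination ℝ γ ∘ₗ (WithLp.linearEquiv 2 ℝ (Fin n → ℝ)).toLinearMap

variable {γ : Fin n → M}

theorem vec_apply (v : EuclideanSpace ℝ (Fin n)) : vec γ v = ∑ i, v i • γ i := rfl

@[simp]
theorem vec_single (i : Fin n) : vec γ (EuclideanSpace.single i 1) = γ i := by
  simp [vec_apply, PiLp.single_apply, ite_smul]

theorem vec_mul_vec_mem_evenSubalgebra (u v : EuclideanSpace ℝ (Fin n)) :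
    vec γ u * vec γ v ∈ evenSubalgebra γ Set.univ := by
  rw [vec_apply, vec_apply, Finset.sum_mul_sum]
  refine sum_mem fun i _ ↦ sum_mem fun j _ ↦ ?_
  rw [smul_mul_smul_comm]
  exact Subalgebra.smul_mem _ (mul_mem_evenSubalgebra (Set.mem_univ i) (Set.mem_univ j)) _

variable [StarRing M]

theorem star_vec [StarModule ℝ M] (hγ : IsCliffordFamily γ) (v : EuclideanSpace ℝ (Fin n)) :
    star (vec γ v) = vec γ v := by
  simp [vec_apply, star_sum, hγ.star_eq]

theorem vec_mul_vec_add (hγ : IsCliffordFamily γ) (u v : EuclideanSpace ℝ (Fin n)) :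
    vec γ u * vec γ v + vec γ v * vec γ u = (2 * inner ℝ u v : ℝ) • (1 : M) := by
  rw [vec_apply, vec_apply, Finset.sum_mul_sum, Finset.sum_mul_sum, Finset.sum_comm (γ := Fin n)
    (f := fun i j ↦ v i • γ i * u j • γ j), ← Finset.sum_add_distrib, PiLp.inner_apply,
    Finset.mul_sum, Finset.sum_smul]
  refine Finset.sum_congr rfl fun i _ ↦ ?_
  rw [← Finset.sum_add_distrib, Finset.sum_eq_single i]
  · simp only [smul_mul_smul_comm, hγ.mul_self, ← add_smul]
    congr 1
    simp
    ring
  · intro j _ hj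
    rw [smul_mul_smul_comm, smul_mul_smul_comm, hγ.anticomm hj, mul_comm, smul_neg, add_neg_cancel]
  · simp

theorem vec_mul_self (hγ : IsCliffordFamily γ) (v : EuclideanSpace ℝ (Fin n)) :
    vec γ v * vec γ v = (‖v‖ ^ 2) • (1 : M) := by
  have := vec_mul_vec_add hγ v v
  rw [← two_smul ℝ, mul_smul, real_inner_self_eq_norm_sq] at this
  exact smul_right_injective M (two_ne_zero (α := ℝ)) this

theorem vec_conj_vec (hγ : IsCliffordFamily γ) {u : EuclideanSpace ℝ (Fin n)} (hu : ‖u‖ = 1)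
    (v : EuclideanSpace ℝ (Fin n)) :
    vec γ u * vec γ v * vec γ u = vec γ ((2 * inner ℝ u v : ℝ) • u - v) := by
  rw [eq_sub_of_add_eq (vec_mul_vec_add hγ u v), sub_mul, mul_assoc, vec_mul_self hγ, hu]
  simp

theorem vec_injective [Nontrivial M] (hγ : IsCliffordFamily γ) :
    Function.Injective (vec γ) := by
  rw [injective_iff_map_eq_zero]
  intro v hv
  have := vec_mul_self hγ v
  rw [hv, mul_zero, eq_comm, smul_eq_zero_iff_left one_ne_zero] at this
  simpa using this

variable (γ) in
/-- A linear left inverse of `vec γ`, when `vec γ` is injective. -/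
noncomputable def coord : M →ₗ[ℝ] EuclideanSpace ℝ (Fin n) := (vec γ).leftInverse

theorem coord_vec [Nontrivial M] (hγ : IsCliffordFamily γ) (v : EuclideanSpace ℝ (Fin n)) :
    coord γ (vec γ v) = v :=
  LinearMap.leftInverse_apply_of_inj (LinearMap.ker_eq_bot.mpr (vec_injective hγ)) v

variable (γ) in
/-- Elements of the even part of the Clifford algebra whose twisted conjugation preserves the
space of vectors. -/
def IsSpin (x : M) : Prop :=
  x ∈ evenSubalgebra γ Set.univ ∧ ∀ v, ∃ w, x * vec γ v * star x = vec γ w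

theorem isSpin_one : IsSpin γ (1 : M) :=
  ⟨one_mem _, fun v ↦ ⟨v, by simp⟩⟩

theorem IsSpin.mul {x y : M} (hx : IsSpin γ x) (hy : IsSpin γ y) : IsSpin γ (x * y) := by
  refine ⟨mul_mem hx.1 hy.1, fun v ↦ ?_⟩
  obtain ⟨w, hw⟩ := hy.2 v
  obtain ⟨w', hw'⟩ := hx.2 w
  refine ⟨w', ?_⟩
  rw [← hw', ← hw, star_mul]
  simp only [mul_assoc]

theorem isSpin_vec_mul_vec [StarModule ℝ M] (hγ : IsCliffordFamily γ)
    {u v : EuclideanSpace ℝ (Fin n)} (hu : ‖u‖ = 1) (hv : ‖v‖ = 1) :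
    IsSpin γ (vec γ u * vec γ v) := by
  refine ⟨vec_mul_vec_mem_evenSubalgebra u v, fun w ↦ ?_⟩
  refine ⟨_, Eq.trans ?_ (vec_conj_vec hγ hu ((2 * inner ℝ v w : ℝ) • v - w))⟩
  rw [← vec_conj_vec hγ hv, star_mul, star_vec hγ, star_vec hγ]
  simp only [mul_assoc]

theorem vec_mul_vec_mem_unitary [StarModule ℝ M] (hγ : IsCliffordFamily γ)
    {u v : EuclideanSpace ℝ (Fin n)} (hu : ‖u‖ = 1) (hv : ‖v‖ = 1) :
    vec γ u * vec γ v ∈ unitary M := by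
  rw [Unitary.mem_iff, star_mul, star_vec hγ, star_vec hγ]
  constructor
  · rw [mul_assoc, ← mul_assoc (vec γ u), vec_mul_self hγ, hu, one_pow, one_smul, one_mul,
      vec_mul_self hγ, hv, one_pow, one_smul]
  · rw [mul_assoc, ← mul_assoc (vec γ v), vec_mul_self hγ, hv, one_pow, one_smul, one_mul,
      vec_mul_self hγ, hu, one_pow, one_smul]

variable (γ) in
/-- The subgroup of the spin group fixing the first `k` basis vectors. -/
def spinStabilizer (k : ℕ) : Subgroup (unitary M) where
  carrier := {S | IsSpin γ (S : M) ∧ IsSpin γ (star (S : M)) ∧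
    ∀ i : Fin n, (i : ℕ) < k → Commute (S : M) (γ i)}
  mul_mem' {S T} hS hT := ⟨hS.1.mul hT.1, by
    rw [Submonoid.coe_mul, star_mul]
    exact hT.2.1.mul hS.2.1, fun i hi ↦ (hS.2.2 i hi).mul_left (hT.2.2 i hi)⟩
  one_mem' := ⟨isSpin_one, by simpa using isSpin_one, fun i _ ↦ Commute.one_left _⟩
  inv_mem' {S} hS := by
    refine ⟨hS.2.1, ?_, fun i hi ↦ ?_⟩
    · rw [← Unitary.star_eq_inv, Unitary.coe_star, star_star]
      exact hS.1
    · rw [← Unitary.star_eq_inv, Unitary.coe_star, commute_iff_eq]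
      calc star (S : M) * γ i = star (S : M) * (γ i * S) * star (S : M) := by
            rw [mul_assoc, mul_assoc, Unitary.mul_star_self_of_mem S.2, mul_one]
        _ = γ i * star (S : M) := by
            rw [← (hS.2.2 i hi).eq, ← mul_assoc, Unitary.star_mul_self_of_mem S.2, one_mul]

variable {k : ℕ}

theorem spinStabilizer_anti {l : ℕ} (h : k ≤ l) : spinStabilizer γ l ≤ spinStabilizer γ k :=
  fun _ hS ↦ ⟨hS.1, hS.2.1, fun i hi ↦ hS.2.2 i (hi.trans_le h)⟩

variable (γ) in
/-- The linear transformation of Euclidean space induced by twisted conjugation. -/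
noncomputable def rotate (S : M) : Module.End ℝ (EuclideanSpace ℝ (Fin n)) :=
  coord γ ∘ₗ LinearMap.mulRight ℝ (star S) ∘ₗ LinearMap.mulLeft ℝ S ∘ₗ vec γ

theorem rotate_apply (S : M) (v : EuclideanSpace ℝ (Fin n)) :
    rotate γ S v = coord γ (S * vec γ v * star S) := rfl

variable [Nontrivial M]

theorem vec_rotate (hγ : IsCliffordFamily γ) {S : M} (hS : IsSpin γ S)
    (v : EuclideanSpace ℝ (Fin n)) : vec γ (rotate γ S v) = S * vec γ v * star S := by
  obtain ⟨w, hw⟩ := hS.2 v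
  rw [rotate_apply, hw, coord_vec hγ]

theorem rotate_eq_iff (hγ : IsCliffordFamily γ) {S : M} (hS : IsSpin γ S)
    {v w : EuclideanSpace ℝ (Fin n)} : rotate γ S v = w ↔ S * vec γ v * star S = vec γ w := by
  rw [← vec_rotate hγ hS, (vec_injective hγ).eq_iff]

theorem rotate_mul (hγ : IsCliffordFamily γ) {S T : M} (hS : IsSpin γ S) (hT : IsSpin γ T) :
    rotate γ (S * T) = rotate γ S * rotate γ T := by
  ext1 v
  rw [rotate_eq_iff hγ (hS.mul hT), Module.End.mul_apply, vec_rotate hγ hS, vec_rotate hγ hT,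
    star_mul]
  simp only [mul_assoc]

theorem rotate_one (hγ : IsCliffordFamily γ) : rotate γ (1 : M) = 1 := by
  ext1 v
  rw [rotate_eq_iff hγ isSpin_one]
  simp

theorem inner_rotate (hγ : IsCliffordFamily γ) {S : M} (hS : IsSpin γ S) (hS' : S ∈ unitary M)
    (v w : EuclideanSpace ℝ (Fin n)) :
    inner ℝ (rotate γ S v) (rotate γ S w) = (inner ℝ v w : ℝ) := by
  have h := vec_mul_vec_add hγ (rotate γ S v) (rotate γ S w)
  have h1 := Unitary.star_mul_self_of_mem hS'
  have h2 := Unitary.mul_star_self_of_mem hS'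
  have h3 : ∀ x y : M, S * x * star S * (S * y * star S) = S * (x * y) * star S := by
    intro x y
    rw [mul_assoc, mul_assoc S y, ← mul_assoc (star S), h1, one_mul]
    simp only [mul_assoc]
  rw [vec_rotate hγ hS, vec_rotate hγ hS, h3, h3, ← add_mul, ← mul_add, vec_mul_vec_add hγ,
    mul_smul_comm, smul_mul_assoc, mul_one, h2] at h
  have := smul_left_injective ℝ (one_ne_zero (α := M)) h
  simpa using this.symm

theorem commute_iff_rotate_single (hγ : IsCliffordFamily γ) {S : M} (hS : IsSpin γ S)
    (hS' : S ∈ unitary M) (i : Fin n) :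
    Commute S (γ i) ↔ rotate γ S (EuclideanSpace.single i 1) = EuclideanSpace.single i 1 := by
  rw [rotate_eq_iff hγ hS, vec_single, commute_iff_eq]
  constructor <;> intro h
  · rw [h, mul_assoc, Unitary.mul_star_self_of_mem hS', mul_one]
  · nth_rw 2 [← h]
    rw [mul_assoc, Unitary.star_mul_self_of_mem hS', mul_one]

end Vectors

section Quaternion

variable {M : Type*} [Ring M] [Algebra ℝ M]

/-- The combination of `1` and three products of pairs with the coefficients of a quaternion. -/
def quaternion (A B C : M) (q : Fin 4 → ℝ) : M :=
  q 0 • (1 : M) + q 1 • (C * B) + q 2 • (B * A) + q 3 • (C * A)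

/-- Conjugation of quaternions in coordinates. -/
def conjCoeff (q : Fin 4 → ℝ) : Fin 4 → ℝ := ![q 0, -q 1, -q 2, -q 3]

variable {A B C : M}

theorem quaternion_mul_conj (hA : A * A = 1) (hB : B * B = 1) (hC : C * C = 1)
    (hBA : B * A = -(A * B)) (hCA : C * A = -(A * C)) (hCB : C * B = -(B * C)) (q : Fin 4 → ℝ) :
    quaternion A B C q * quaternion A B C (conjCoeff q) =
      (q 0 ^ 2 + q 1 ^ 2 + q 2 ^ 2 + q 3 ^ 2) • (1 : M) := by
  have hA' (x : M) : A * (A * x) = x := by rw [← mul_assoc, hA, one_mul]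
  have hB' (x : M) : B * (B * x) = x := by rw [← mul_assoc, hB, one_mul]
  have hBA' (x : M) : B * (A * x) = -(A * (B * x)) := by rw [← mul_assoc, hBA, neg_mul, mul_assoc]
  have hCA' (x : M) : C * (A * x) = -(A * (C * x)) := by rw [← mul_assoc, hCA, neg_mul, mul_assoc]
  have hCB' (x : M) : C * (B * x) = -(B * (C * x)) := by rw [← mul_assoc, hCB, neg_mul, mul_assoc]
  simp only [quaternion, conjCoeff, Matrix.cons_val, mul_add, add_mul, mul_smul_comm,
    smul_mul_assoc, mul_one, one_mul, mul_assoc, hA, hB, hC, hBA, hCA, hCB, hA', hB', hBA', hCA',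
    hCB', mul_neg, neg_mul, neg_neg, smul_neg, neg_smul]
  module

theorem quaternion_conj_vector (hA : A * A = 1) (hB : B * B = 1) (hC : C * C = 1)
    (hBA : B * A = -(A * B)) (hCA : C * A = -(A * C)) (hCB : C * B = -(B * C)) (q : Fin 4 → ℝ) :
    quaternion A B C q * A * quaternion A B C (conjCoeff q) =
        (q 0 ^ 2 + q 1 ^ 2 - q 2 ^ 2 - q 3 ^ 2) • A + (2 * q 0 * q 2 - 2 * q 1 * q 3) • B +
          (2 * q 0 * q 3 + 2 * q 1 * q 2) • C ∧
      quaternion A B C q * B * quaternion A B C (conjCoeff q) =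
        (-2 * q 0 * q 2 - 2 * q 1 * q 3) • A + (q 0 ^ 2 - q 1 ^ 2 - q 2 ^ 2 + q 3 ^ 2) • B +
          (2 * q 0 * q 1 - 2 * q 2 * q 3) • C ∧
      quaternion A B C q * C * quaternion A B C (conjCoeff q) =
        (-2 * q 0 * q 3 + 2 * q 1 * q 2) • A + (-2 * q 0 * q 1 - 2 * q 2 * q 3) • B +
          (q 0 ^ 2 - q 1 ^ 2 + q 2 ^ 2 - q 3 ^ 2) • C := by
  have hA' (x : M) : A * (A * x) = x := by rw [← mul_assoc, hA, one_mul]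
  have hB' (x : M) : B * (B * x) = x := by rw [← mul_assoc, hB, one_mul]
  have hBA' (x : M) : B * (A * x) = -(A * (B * x)) := by rw [← mul_assoc, hBA, neg_mul, mul_assoc]
  have hCA' (x : M) : C * (A * x) = -(A * (C * x)) := by rw [← mul_assoc, hCA, neg_mul, mul_assoc]
  have hCB' (x : M) : C * (B * x) = -(B * (C * x)) := by rw [← mul_assoc, hCB, neg_mul, mul_assoc]
  refine ⟨?_, ?_, ?_⟩ <;>
  · simp only [quaternion, conjCoeff, Matrix.cons_val, mul_add, add_mul, mul_smul_comm,
      smul_mul_assoc, mul_one, one_mul, mul_assoc, hB, hC, hBA, hCA, hCB, hA', hB', hBA',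
      hCA', hCB', mul_neg, neg_mul, neg_neg, smul_neg, neg_smul]
    module

end Quaternion

section Stabilizers

variable {n k : ℕ} {M : Type*} [Ring M] [Algebra ℝ M] [StarRing M] {γ : Fin n → M}

theorem mem_evenSubalgebra_of_mem_spinStabilizer (hγ : IsCliffordFamily γ) (hk : k < n)
    {S : unitary M} (hS : S ∈ spinStabilizer γ k) :
    (S : M) ∈ evenSubalgebra γ {i | k ≤ (i : ℕ)} := by
  induction k with
  | zero => simpa using hS.1.1
  | succ k ih =>
    have h := ih (by omega) (spinStabilizer_anti k.le_succ hS)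
    refine mem_evenSubalgebra_of_commute hγ (a := ⟨k, by omega⟩) (b := ⟨k + 1, hk⟩)
      (by simp) (by simp) ?_ (hS.2.2 ⟨k, by omega⟩ (by simp))
    convert h using 2
    ext i
    simp only [Set.mem_insert_iff, Set.mem_ofPred_eq, Fin.ext_iff]
    omega

theorem eq_one_or_eq_neg_one_of_mem_spinStabilizer [StarModule ℝ M] [Nontrivial M]
    (hγ : IsCliffordFamily γ) (hk : n = k + 1) {S : unitary M} (hS : S ∈ spinStabilizer γ k) :
    (S : M) = 1 ∨ (S : M) = -1 := by
  have h := mem_evenSubalgebra_of_mem_spinStabilizer hγ (by omega) hS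
  have hset : {i : Fin n | k ≤ (i : ℕ)} = {⟨k, by omega⟩} := by
    ext i
    simp only [Set.mem_singleton_iff, Set.mem_ofPred_eq, Fin.ext_iff]
    omega
  rw [hset] at h
  obtain ⟨r, hr⟩ := exists_of_mem_evenSubalgebra_singleton hγ h
  have h1 := Unitary.star_mul_self_of_mem S.2
  rw [hr, star_smul, star_one, smul_mul_smul_comm, mul_one, star_trivial] at h1
  have h2 : r * r = 1 := smul_left_injective ℝ (one_ne_zero (α := M)) (by simpa using h1)
  rcases mul_self_eq_one_iff.mp h2 with rfl | rfl
  · exact .inl (by rw [hr, one_smul])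
  · exact .inr (by rw [hr, neg_one_smul])

theorem neg_one_mem_spinStabilizer : (-1 : unitary M) ∈ spinStabilizer γ k := by
  have : IsSpin γ (-1 : M) := ⟨neg_mem (one_mem _), fun v ↦ ⟨v, by simp⟩⟩
  refine ⟨this, by simpa [Unitary.coe_neg] using this, fun i _ ↦ ?_⟩
  simp [commute_iff_eq, Unitary.coe_neg]

variable [StarModule ℝ M]

theorem star_quaternion {A B C : M} (hA : star A = A) (hB : star B = B) (hC : star C = C)
    (hBA : B * A = -(A * B)) (hCA : C * A = -(A * C)) (hCB : C * B = -(B * C)) (q : Fin 4 → ℝ) :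
    star (quaternion A B C q) = quaternion A B C (conjCoeff q) := by
  simp [quaternion, conjCoeff, hA, hB, hC, hBA, hCA, hCB]

theorem isSpin_quaternion (hγ : IsCliffordFamily γ) {a b c : Fin n} (hab : a ≠ b) (hac : a ≠ c)
    (hbc : b ≠ c) {q : Fin 4 → ℝ} (hq : q 0 ^ 2 + q 1 ^ 2 + q 2 ^ 2 + q 3 ^ 2 = 1) :
    IsSpin γ (quaternion (γ a) (γ b) (γ c) q) ∧
      ∀ i, i ≠ a → i ≠ b → i ≠ c → Commute (quaternion (γ a) (γ b) (γ c) q) (γ i) := by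
  have hmem : ∀ J : Set (Fin n), a ∈ J → b ∈ J → c ∈ J →
      quaternion (γ a) (γ b) (γ c) q ∈ evenSubalgebra γ J := fun J ha hb hc ↦
    add_mem (add_mem (add_mem (Subalgebra.smul_mem _ (one_mem _) _)
      (Subalgebra.smul_mem _ (mul_mem_evenSubalgebra hc hb) _))
      (Subalgebra.smul_mem _ (mul_mem_evenSubalgebra hb ha) _))
      (Subalgebra.smul_mem _ (mul_mem_evenSubalgebra hc ha) _)
  have hcomm : ∀ i, i ≠ a → i ≠ b → i ≠ c → Commute (quaternion (γ a) (γ b) (γ c) q) (γ i) :=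
    fun i hia hib hic ↦ (commute_of_mem_evenSubalgebra hγ (J := {a, b, c})
      (by simp [hia, hib, hic]) (hmem _ (by simp) (by simp) (by simp))).symm
  refine ⟨⟨hmem _ trivial trivial trivial, fun v ↦ ?_⟩, hcomm⟩
  rw [star_quaternion (hγ.star_eq a) (hγ.star_eq b) (hγ.star_eq c) (hγ.anticomm hab.symm)
    (hγ.anticomm hac.symm) (hγ.anticomm hbc.symm)]
  have hn := quaternion_mul_conj (hγ.mul_self a) (hγ.mul_self b) (hγ.mul_self c)
    (hγ.anticomm hab.symm) (hγ.anticomm hac.symm) (hγ.anticomm hbc.symm) q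
  obtain ⟨ea, eb, ec⟩ := quaternion_conj_vector (hγ.mul_self a) (hγ.mul_self b) (hγ.mul_self c)
    (hγ.anticomm hab.symm) (hγ.anticomm hac.symm) (hγ.anticomm hbc.symm) q
  rw [hq, one_smul] at hn
  have hγr : ∀ i, γ i ∈ LinearMap.range (vec γ) := fun i ↦ ⟨_, vec_single i⟩
  suffices h : quaternion (γ a) (γ b) (γ c) q * vec γ v *
      quaternion (γ a) (γ b) (γ c) (conjCoeff q) ∈ LinearMap.range (vec γ) by
    obtain ⟨w, hw⟩ := h
    exact ⟨w, hw.symm⟩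
  rw [vec_apply, Finset.mul_sum, Finset.sum_mul]
  refine sum_mem fun i _ ↦ ?_
  rw [mul_smul_comm, smul_mul_assoc]
  refine Submodule.smul_mem _ _ ?_
  have hlin : ∀ x y z : ℝ, x • γ a + y • γ b + z • γ c ∈ LinearMap.range (vec γ) := fun x y z ↦
    add_mem (add_mem (Submodule.smul_mem _ _ (hγr a)) (Submodule.smul_mem _ _ (hγr b)))
      (Submodule.smul_mem _ _ (hγr c))
  by_cases hia : i = a
  · rw [hia, ea]
    exact hlin _ _ _
  by_cases hib : i = b
  · rw [hib, eb]
    exact hlin _ _ _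
  by_cases hic : i = c
  · rw [hic, ec]
    exact hlin _ _ _
  rw [(hcomm i hia hib hic).eq, mul_assoc, hn, mul_one]
  exact hγr i

theorem simplyConnectedSpace_spinStabilizer_of_eq_add_three [Nontrivial M] [TopologicalSpace M]
    [IsTopologicalRing M] [ContinuousSMul ℝ M] [T2Space M]
    (hγ : IsCliffordFamily γ) (hn : n = k + 3) : SimplyConnectedSpace (spinStabilizer γ k) := by
  let a : Fin n := ⟨k, by omega⟩
  let b : Fin n := ⟨k + 1, by omega⟩
  let c : Fin n := ⟨k + 2, by omega⟩
  have hab : a ≠ b := by simp [a, b]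
  have hac : a ≠ c := by simp [a, c]
  have hbc : b ≠ c := by simp [b, c]
  have hmul := quaternion_mul_conj (hγ.mul_self a) (hγ.mul_self b) (hγ.mul_self c)
    (hγ.anticomm hab.symm) (hγ.anticomm hac.symm) (hγ.anticomm hbc.symm)
  have hstar := star_quaternion (hγ.star_eq a) (hγ.star_eq b) (hγ.star_eq c)
    (hγ.anticomm hab.symm) (hγ.anticomm hac.symm) (hγ.anticomm hbc.symm)
  have hconj2 : ∀ q, conjCoeff (conjCoeff q) = q := by
    intro q
    ext i
    fin_cases i <;> simp [conjCoeff]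
  have hconj : ∀ q : Fin 4 → ℝ, conjCoeff q 0 ^ 2 + conjCoeff q 1 ^ 2 + conjCoeff q 2 ^ 2 +
      conjCoeff q 3 ^ 2 = q 0 ^ 2 + q 1 ^ 2 + q 2 ^ 2 + q 3 ^ 2 := by
    intro q
    simp [conjCoeff]
  have hS : ∀ q : Metric.sphere (0 : EuclideanSpace ℝ (Fin 4)) 1,
      q.1 0 ^ 2 + q.1 1 ^ 2 + q.1 2 ^ 2 + q.1 3 ^ 2 = 1 := by
    intro q
    have h := EuclideanSpace.real_norm_sq_eq q.1
    rw [mem_sphere_zero_iff_norm.mp q.2, Fin.sum_univ_four] at h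
    linarith
  let f : Metric.sphere (0 : EuclideanSpace ℝ (Fin 4)) 1 → spinStabilizer γ k := fun q ↦
    ⟨⟨quaternion (γ a) (γ b) (γ c) q.1, by
      rw [Unitary.mem_iff, hstar, hmul, hS, one_smul]
      refine ⟨?_, rfl⟩
      nth_rw 2 [← hconj2 q.1]
      rw [hmul, hconj, hS, one_smul]⟩, by
      refine ⟨(isSpin_quaternion hγ hab hac hbc (hS q)).1, ?_, fun i hi ↦ ?_⟩
      · simp only [hstar]
        exact (isSpin_quaternion hγ hab hac hbc ((hconj _).trans (hS q))).1
      · refine (isSpin_quaternion hγ hab hac hbc (hS q)).2 i ?_ ?_ ?_ <;>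
        · simp only [a, b, c, ne_eq, Fin.ext_iff]
          omega⟩
  have hf : Continuous f := by
    refine Continuous.subtype_mk (Continuous.subtype_mk ?_ _) _
    unfold quaternion
    fun_prop
  have hinj : Function.Injective f := by
    intro q q' h
    have h1 : quaternion (γ a) (γ b) (γ c) (q.1 - q'.1) = 0 := by
      have : quaternion (γ a) (γ b) (γ c) q.1 = quaternion (γ a) (γ b) (γ c) q'.1 :=
        congrArg (fun S : spinStabilizer γ k ↦ (S : M)) h
      rw [← sub_eq_zero] at this
      rw [← this]
      simp only [quaternion, Pi.sub_apply]
      module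
    have h2 := hmul (q.1 - q'.1)
    rw [h1, zero_mul, eq_comm, smul_eq_zero_iff_left one_ne_zero] at h2
    have h3 := EuclideanSpace.real_norm_sq_eq (q.1 - q'.1)
    rw [WithLp.ofLp_sub, Fin.sum_univ_four, h2, pow_eq_zero_iff two_ne_zero, norm_eq_zero,
      sub_eq_zero] at h3
    exact Subtype.ext h3
  have hsurj : Function.Surjective f := by
    intro S
    have h := mem_evenSubalgebra_of_mem_spinStabilizer hγ (by omega) S.2
    have hset : {i : Fin n | k ≤ (i : ℕ)} = {a, b, c} := by
      ext i
      simp only [a, b, c, Set.mem_insert_iff, Set.mem_singleton_iff, Set.mem_ofPred_eq, Fin.ext_iff]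
      omega
    rw [hset] at h
    obtain ⟨q, hq⟩ := exists_of_mem_evenSubalgebra_triple hγ hab hac hbc h
    have h1 := hmul q
    rw [← hstar] at h1
    have h2 : ((S : unitary M) : M) = quaternion (γ a) (γ b) (γ c) q := hq
    rw [← h2, Unitary.mul_star_self_of_mem S.1.2] at h1
    have h3 : q 0 ^ 2 + q 1 ^ 2 + q 2 ^ 2 + q 3 ^ 2 = 1 :=
      smul_left_injective ℝ (one_ne_zero (α := M)) (by simpa using h1.symm)
    refine ⟨⟨WithLp.toLp 2 q, ?_⟩, Subtype.ext (Subtype.ext h2.symm)⟩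
    rw [mem_sphere_zero_iff_norm, ← pow_eq_one_iff_of_nonneg (norm_nonneg _) two_ne_zero,
      EuclideanSpace.real_norm_sq_eq, Fin.sum_univ_four]
    exact h3
  have hrank : 2 < Module.rank ℝ (EuclideanSpace ℝ (Fin 4)) := by
    rw [← Module.finrank_eq_rank, finrank_euclideanSpace_fin]
    norm_num
  have := simplyConnectedSpace_sphere hrank
  have e : Metric.sphere (0 : EuclideanSpace ℝ (Fin 4)) 1 ≃ₜ spinStabilizer γ k :=
    Continuous.homeoOfEquivCompactToT2 (f := Equiv.ofBijective f ⟨hinj, hsurj⟩) hf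
  exact e.symm.toHomotopyEquiv.simplyConnectedSpace

end Stabilizers

/-- The subspace of vectors whose first `k` coordinates vanish. -/
def tailSubspace (n k : ℕ) : Submodule ℝ (EuclideanSpace ℝ (Fin n)) where
  carrier := {v | ∀ i : Fin n, (i : ℕ) < k → v i = 0}
  add_mem' hv hw i hi := by simp [hv i hi, hw i hi]
  zero_mem' i _ := by simp
  smul_mem' c v hv i hi := by simp [hv i hi]

theorem single_mem_tailSubspace {n k : ℕ} {i : Fin n} (hi : k ≤ i) :
    EuclideanSpace.single i 1 ∈ tailSubspace n k := by
  intro j hj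
  rw [PiLp.single_apply, if_neg]
  rintro rfl
  omega

theorem two_lt_rank_tailSubspace {n k : ℕ} (h : k + 3 ≤ n) :
    2 < Module.rank ℝ (tailSubspace n k) := by
  let f : Fin 3 → Fin n := fun j ↦ ⟨k + j, by omega⟩
  have hf : Function.Injective f := by
    intro i j hij
    simp only [f, Fin.mk.injEq] at hij
    omega
  have h1 : LinearIndependent ℝ fun j ↦ EuclideanSpace.basisFun (Fin n) ℝ (f j) :=
    (EuclideanSpace.basisFun (Fin n) ℝ).orthonormal.linearIndependent.comp f hf
  have h2 : LinearIndependent ℝ fun j : Fin 3 ↦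
      (⟨EuclideanSpace.single (f j) 1, single_mem_tailSubspace (by simp [f])⟩ :
        tailSubspace n k) := by
    refine LinearIndependent.of_comp (tailSubspace n k).subtype ?_
    convert h1 using 1
    ext1 j
    simp
  have h3 := h2.cardinal_le_rank
  rw [Cardinal.mk_fin] at h3
  exact lt_of_lt_of_le (by norm_num) h3

section Continuity

variable {n : ℕ} {M : Type*} [Ring M] [Algebra ℝ M] {γ : Fin n → M} [TopologicalSpace M]
  [IsTopologicalRing M] [ContinuousSMul ℝ M]

theorem continuous_vec : Continuous (vec γ) :=
  LinearMap.continuous_of_finiteDimensional _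

theorem continuous_rotate [StarRing M] [ContinuousStar M] [T2Space M] [FiniteDimensional ℝ M]
    (v : EuclideanSpace ℝ (Fin n)) : Continuous fun S : M ↦ rotate γ S v := by
  have : Continuous (coord γ) := LinearMap.continuous_of_finiteDimensional _
  simp only [rotate_apply]
  fun_prop

end Continuity

section Stabilizers

variable {n k : ℕ} {M : Type*} [Ring M] [Algebra ℝ M] [StarRing M] {γ : Fin n → M}

theorem commute_vec_mul_vec (hγ : IsCliffordFamily γ) {u v : EuclideanSpace ℝ (Fin n)} {i : Fin n}
    (hu : u i = 0) (hv : v i = 0) : Commute (vec γ u * vec γ v) (γ i) := by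
  have h : ∀ w : EuclideanSpace ℝ (Fin n), w i = 0 → vec γ w * γ i = -(γ i * vec γ w) := by
    intro w hw
    have := vec_mul_vec_add hγ w (EuclideanSpace.single i 1)
    rw [vec_single] at this
    rw [eq_neg_iff_add_eq_zero, this]
    simp [EuclideanSpace.inner_single_right, hw]
  rw [commute_iff_eq, mul_assoc, h v hv, mul_neg, ← mul_assoc, h u hu, neg_mul, neg_neg, mul_assoc]

section Rotor

variable [StarModule ℝ M]

/-- The product of two unit vectors as an element of the spin group. -/
noncomputable def rotor (hγ : IsCliffordFamily γ) {u v : EuclideanSpace ℝ (Fin n)} (hu : ‖u‖ = 1)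
    (hv : ‖v‖ = 1) : unitary M :=
  ⟨vec γ u * vec γ v, vec_mul_vec_mem_unitary hγ hu hv⟩

theorem rotor_mem_spinStabilizer (hγ : IsCliffordFamily γ) {u v : EuclideanSpace ℝ (Fin n)}
    (hu : ‖u‖ = 1) (hv : ‖v‖ = 1) (hu' : u ∈ tailSubspace n k) (hv' : v ∈ tailSubspace n k) :
    rotor hγ hu hv ∈ spinStabilizer γ k := by
  refine ⟨isSpin_vec_mul_vec hγ hu hv, ?_, fun i hi ↦ commute_vec_mul_vec hγ (hu' i hi) (hv' i hi)⟩
  change IsSpin γ (star (vec γ u * vec γ v))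
  rw [star_mul, star_vec hγ, star_vec hγ]
  exact isSpin_vec_mul_vec hγ hv hu

end Rotor

variable [Nontrivial M]

theorem rotate_mem_tailSubspace (hγ : IsCliffordFamily γ) {S : unitary M}
    (hS : S ∈ spinStabilizer γ k) {v : EuclideanSpace ℝ (Fin n)} (hv : v ∈ tailSubspace n k) :
    rotate γ (S : M) v ∈ tailSubspace n k := by
  intro i hi
  have h := inner_rotate hγ hS.1 S.2 (EuclideanSpace.single i 1) v
  rw [(commute_iff_rotate_single hγ hS.1 S.2 i).mp (hS.2.2 i hi)] at h
  simpa [EuclideanSpace.inner_single_left, hv i hi] using h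

/-- The action of the stabilizer of the first `k` basis vectors on the remaining coordinates. -/
noncomputable def tailAction (hγ : IsCliffordFamily γ) (k : ℕ) :
    spinStabilizer γ k →* Module.End ℝ (tailSubspace n k) where
  toFun S := (rotate γ ((S : unitary M) : M)).restrict fun _ hv ↦ rotate_mem_tailSubspace hγ S.2 hv
  map_one' := by
    ext1 v
    exact Subtype.ext (by simp [rotate_one hγ])
  map_mul' S T := by
    ext1 v
    exact Subtype.ext (by simp [rotate_mul hγ S.2.1 T.2.1])

theorem coe_tailAction (hγ : IsCliffordFamily γ) (S : spinStabilizer γ k)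
    (v : tailSubspace n k) :
    (tailAction hγ k S v : EuclideanSpace ℝ (Fin n)) = rotate γ ((S : unitary M) : M) v := rfl

theorem norm_rotate (hγ : IsCliffordFamily γ) {S : M} (hS : IsSpin γ S) (hS' : S ∈ unitary M)
    (v : EuclideanSpace ℝ (Fin n)) : ‖rotate γ S v‖ = ‖v‖ := by
  rw [← pow_left_inj₀ (norm_nonneg _) (norm_nonneg _) two_ne_zero, ← real_inner_self_eq_norm_sq,
    inner_rotate hγ hS hS', real_inner_self_eq_norm_sq]

variable [StarModule ℝ M]

theorem rotate_rotor (hγ : IsCliffordFamily γ) {u v : EuclideanSpace ℝ (Fin n)}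
    (hu : ‖u‖ = 1) (hv : ‖v‖ = 1) :
    rotate γ (rotor hγ hu hv : M) v = (2 * inner ℝ u v : ℝ) • u - v := by
  refine (rotate_eq_iff hγ (isSpin_vec_mul_vec hγ hu hv)).mpr ?_
  rw [← vec_conj_vec hγ hu]
  rw [star_mul, star_vec hγ, star_vec hγ, mul_assoc (vec γ u) (vec γ v) (vec γ v),
    vec_mul_self hγ, hv, one_pow, one_smul, mul_one, mul_assoc]

theorem simplyConnectedSpace_spinStabilizer [TopologicalSpace M] [IsTopologicalRing M]
    [ContinuousStar M] [ContinuousSMul ℝ M] [T2Space M] [FiniteDimensional ℝ M]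
    (hγ : IsCliffordFamily γ) (hk : k + 3 ≤ n) : SimplyConnectedSpace (spinStabilizer γ k) := by
  obtain ⟨d, hd⟩ := Nat.exists_eq_add_of_le hk
  induction d generalizing k with
  | zero => exact simplyConnectedSpace_spinStabilizer_of_eq_add_three hγ hd
  | succ d ih =>
    have hsc : SimplyConnectedSpace (spinStabilizer γ (k + 1)) := ih (by omega) (by omega)
    let e : EuclideanSpace ℝ (Fin n) := EuclideanSpace.single ⟨k, by omega⟩ 1
    have he : ‖e‖ = 1 := by simp [e]
    have heW : e ∈ tailSubspace n k := single_mem_tailSubspace le_rfl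
    let H : Subgroup (spinStabilizer γ k) :=
      (spinStabilizer γ (k + 1)).subgroupOf (spinStabilizer γ k)
    have hH : ∀ S, S ∈ H ↔ tailAction hγ k S ⟨e, heW⟩ = ⟨e, heW⟩ := by
      intro S
      rw [Subgroup.mem_subgroupOf, Subtype.ext_iff, coe_tailAction,
        ← commute_iff_rotate_single hγ S.2.1 S.1.2]
      refine ⟨fun h ↦ h.2.2 _ (by simp), fun h ↦ ⟨S.2.1, S.2.2.1, fun i hi ↦ ?_⟩⟩
      rcases Nat.lt_succ_iff_lt_or_eq.mp hi with hi | hi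
      · exact S.2.2.2 i hi
      · convert h
    have eH : H ≃ₜ spinStabilizer γ (k + 1) :=
      { toFun := fun S ↦ ⟨S.1.1, S.2⟩
        invFun := fun S ↦ ⟨⟨S.1, spinStabilizer_anti k.le_succ S.2⟩, S.2⟩
        left_inv := fun _ ↦ rfl
        right_inv := fun _ ↦ rfl
        continuous_toFun := by fun_prop
        continuous_invFun := by fun_prop }
    have : SimplyConnectedSpace H := eH.toHomotopyEquiv.simplyConnectedSpace
    have hu : ∀ u : Metric.sphere (0 : tailSubspace n k) 1,
        ‖((u : tailSubspace n k) : EuclideanSpace ℝ (Fin n))‖ = 1 :=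
      fun u ↦ mem_sphere_zero_iff_norm.mp u.2
    refine simplyConnectedSpace_of_stabilizer (two_lt_rank_tailSubspace hk) (tailAction hγ k)
      (e := ⟨e, heW⟩) he (fun S ↦ ?_) ?_
      (fun u ↦ ⟨rotor hγ (hu u) he, rotor_mem_spinStabilizer hγ _ _ u.1.2 heW⟩) ?_ ?_ ?_ H hH
    · exact (norm_rotate hγ S.2.1 S.1.2 _).trans he
    · refine Continuous.subtype_mk ?_ _
      exact (continuous_rotate e).comp (continuous_subtype_val.comp continuous_subtype_val)
    · refine Continuous.subtype_mk (Continuous.subtype_mk ?_ _) _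
      exact ((continuous_vec (γ := γ)).comp
        (continuous_subtype_val.comp continuous_subtype_val)).mul continuous_const
    · rintro ⟨⟨u, hu₁⟩, hu₂⟩ h
      obtain rfl : u = e := congrArg Subtype.val h
      refine Subtype.ext (Subtype.ext ?_)
      change vec γ e * vec γ e = 1
      rw [vec_mul_self hγ, he, one_pow, one_smul]
    · intro u
      refine Subtype.ext ?_
      exact rotate_rotor hγ (hu u) he

end Stabilizers

end CliffordFamily

/-- The fundamental group of the quotient of a simply connected topological group by a finite cyclic
subgroup is cyclic of the same order. -/
theorem nonempty_fundamentalGroup_mulEquiv_zmod {E X : Type*} [Group E] [TopologicalSpace E]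
    [IsTopologicalGroup E] [T2Space E] [SimplyConnectedSpace E] [TopologicalSpace X] {f : E → X}
    (hf : Topology.IsQuotientMap f) {g : E} {m : ℕ} [NeZero m] (hg : orderOf g = m)
    (hfg : ∀ {a b}, f a = f b ↔ a⁻¹ * b ∈ Subgroup.zpowers g) (x : X) :
    Nonempty (FundamentalGroup X x ≃* Multiplicative (ZMod m)) := by
  have hfin : (Subgroup.zpowers g : Set E).Finite :=
    finite_zpowers.mpr (orderOf_pos_iff.mp (hg ▸ NeZero.pos m))
  have := hfin.to_subtype
  have hcov := hf.isQuotientCoveringMap_of_subgroupOp (Subgroup.zpowers g)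
    ⟨inferInstance⟩ hfg
  obtain ⟨e, he⟩ := hf.surjective x
  have hcard : Nat.card (Subgroup.zpowers g) = m := by rw [Nat.card_zpowers, hg]
  let e₁ : (Subgroup.zpowers g).opᵐᵒᵖ ≃* Subgroup.zpowers g :=
    { toFun := fun a ↦ ⟨a.unop.1.unop, a.unop.2⟩
      invFun := fun a ↦ MulOpposite.op ⟨MulOpposite.op a.1, a.2⟩
      left_inv := fun _ ↦ rfl
      right_inv := fun _ ↦ rfl
      map_mul' := fun _ _ ↦ rfl }
  refine ⟨((hcov.fundamentalGroupEquiv ⟨e, he⟩).trans e₁).trans ?_⟩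
  rw [← hcard]
  exact (zmodCyclicMulEquiv inferInstance).symm

namespace CliffordFamily

section Frames

variable {n : ℕ} {M : Type*} [Ring M] [Algebra ℝ M] [StarRing M] [Nontrivial M] {γ : Fin n → M}

/-- The action of the spin group on Euclidean space by rotations. -/
noncomputable def rotation (hγ : IsCliffordFamily γ) :
    spinStabilizer γ 0 →* Module.End ℝ (EuclideanSpace ℝ (Fin n)) where
  toFun S := rotate γ ((S : unitary M) : M)
  map_one' := rotate_one hγ
  map_mul' S T := rotate_mul hγ S.2.1 T.2.1

theorem rotation_apply (hγ : IsCliffordFamily γ) (S : spinStabilizer γ 0) :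
    rotation hγ S = rotate γ ((S : unitary M) : M) := rfl

theorem rotation_inv_apply_eq_iff (hγ : IsCliffordFamily γ) {S : spinStabilizer γ 0}
    {v w : EuclideanSpace ℝ (Fin n)} : rotation hγ S⁻¹ v = w ↔ v = rotation hγ S w := by
  constructor <;> rintro rfl
  · rw [← Module.End.mul_apply, ← map_mul, mul_inv_cancel, map_one, Module.End.one_apply]
  · rw [← Module.End.mul_apply, ← map_mul, inv_mul_cancel, map_one, Module.End.one_apply]

theorem inner_rotation (hγ : IsCliffordFamily γ) (S : spinStabilizer γ 0)
    (v w : EuclideanSpace ℝ (Fin n)) :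
    inner ℝ (rotation hγ S v) (rotation hγ S w) = (inner ℝ v w : ℝ) :=
  inner_rotate hγ S.2.1 S.1.2 v w

theorem coe_mem_spinStabilizer_iff (hγ : IsCliffordFamily γ) {k : ℕ} {S : spinStabilizer γ 0} :
    (S : unitary M) ∈ spinStabilizer γ k ↔ ∀ i : Fin n, (i : ℕ) < k →
      rotation hγ S (EuclideanSpace.single i 1) = EuclideanSpace.single i 1 := by
  simp only [rotation_apply, ← commute_iff_rotate_single hγ S.2.1 S.1.2]
  exact ⟨fun h ↦ h.2.2, fun h ↦ ⟨S.2.1, S.2.2.1, h⟩⟩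

/-- The frame consisting of the images of the first `m` basis vectors under an element of the spin
group. -/
noncomputable def frame (hγ : IsCliffordFamily γ) {m : ℕ} (hm : m ≤ n) (S : spinStabilizer γ 0) :
    RStiefel n m :=
  ⟨Matrix.of fun i j ↦ rotation hγ S (EuclideanSpace.single (Fin.castLE hm i) 1) j, by
    ext i j
    have h := inner_rotation hγ S (EuclideanSpace.single (Fin.castLE hm j) 1)
      (EuclideanSpace.single (Fin.castLE hm i) 1)
    rw [PiLp.inner_apply] at h
    simpa [Matrix.mul_apply, Matrix.one_apply, EuclideanSpace.inner_single_left, eq_comm]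
      using h⟩

theorem frame_eq_iff (hγ : IsCliffordFamily γ) {m : ℕ} (hm : m ≤ n) {S : spinStabilizer γ 0}
    {A : RStiefel n m} : frame hγ hm S = A ↔
      ∀ i, rotation hγ S (EuclideanSpace.single (Fin.castLE hm i) 1) = WithLp.toLp 2 (A.1 i) := by
  rw [Subtype.ext_iff, ← Matrix.ext_iff]
  simp only [PiLp.ext_iff]
  rfl

theorem frame_eq_frame_iff (hγ : IsCliffordFamily γ) {m : ℕ} (hm : m ≤ n)
    {S T : spinStabilizer γ 0} :
    frame hγ hm S = frame hγ hm T ↔ ((S⁻¹ * T : spinStabilizer γ 0) : unitary M) ∈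
      spinStabilizer γ m := by
  rw [coe_mem_spinStabilizer_iff hγ, frame_eq_iff]
  simp only [map_mul, Module.End.mul_apply, rotation_inv_apply_eq_iff]
  exact ⟨fun h i hi ↦ (h ⟨i, hi⟩).symm, fun h i ↦ (h (Fin.castLE hm i) i.2).symm⟩

theorem frame_mul_eq_neg (hγ : IsCliffordFamily γ) {m : ℕ} (hm : m ≤ n)
    {S T : spinStabilizer γ 0} (hT : ∀ i : Fin m, rotation hγ T
      (EuclideanSpace.single (Fin.castLE hm i) 1) = -EuclideanSpace.single (Fin.castLE hm i) 1) :
    (frame hγ hm (S * T)).1 = -(frame hγ hm S).1 := by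
  ext i j
  simp [frame, hT]

theorem rotate_single_eq_neg (hγ : IsCliffordFamily γ) {S : M} (hS : IsSpin γ S)
    (hS' : S ∈ unitary M) {i : Fin n} (h : S * γ i = -(γ i * S)) :
    rotate γ S (EuclideanSpace.single i 1) = -EuclideanSpace.single i 1 := by
  rw [rotate_eq_iff hγ hS, map_neg, vec_single, h, neg_mul, mul_assoc,
    Unitary.mul_star_self_of_mem hS', mul_one]

variable [StarModule ℝ M]

theorem exists_rotate_single_eq (hγ : IsCliffordFamily γ) {i : Fin n} (hi : (i : ℕ) + 1 < n)
    {w : EuclideanSpace ℝ (Fin n)} (hw : w ∈ tailSubspace n i) (hw' : ‖w‖ = 1) :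
    ∃ S ∈ spinStabilizer γ i, rotate γ (S : M) (EuclideanSpace.single i 1) = w := by
  set e : EuclideanSpace ℝ (Fin n) := EuclideanSpace.single i 1 with he_def
  have he : ‖e‖ = 1 := by simp [e]
  have heW : e ∈ tailSubspace n i := single_mem_tailSubspace le_rfl
  by_cases h : w = -e
  · let u : EuclideanSpace ℝ (Fin n) := EuclideanSpace.single ⟨i + 1, hi⟩ 1
    have hu : ‖u‖ = 1 := by simp [u]
    have huW : u ∈ tailSubspace n i := single_mem_tailSubspace (Nat.le_succ _)
    refine ⟨rotor hγ hu he, rotor_mem_spinStabilizer hγ hu he huW heW, ?_⟩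
    have hue : inner ℝ u e = (0 : ℝ) := by
      rw [EuclideanSpace.inner_single_left, he_def, PiLp.single_apply, if_neg]
      · simp
      · simp [Fin.ext_iff]
    rw [rotate_rotor, hue, mul_zero, zero_smul, zero_sub, h]
  · have hn : e + w ≠ 0 := fun h' ↦ h (eq_neg_of_add_eq_zero_right h')
    have hu : ‖‖e + w‖⁻¹ • (e + w)‖ = 1 := norm_smul_inv_norm (𝕜 := ℝ) hn
    have huW : ‖e + w‖⁻¹ • (e + w) ∈ tailSubspace n i :=
      Submodule.smul_mem _ _ (add_mem heW hw)
    refine ⟨rotor hγ hu he, rotor_mem_spinStabilizer hγ hu he huW heW, ?_⟩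
    rw [rotate_rotor, half_turn_normalize_add he hw' h]

theorem frame_surjective (hγ : IsCliffordFamily γ) {m : ℕ} (hm : m + 1 ≤ n) :
    Function.Surjective (frame hγ ((Nat.le_succ m).trans hm)) := by
  intro A
  have hA : ∀ i j, inner ℝ (WithLp.toLp 2 (A.1 i)) (WithLp.toLp 2 (A.1 j)) =
      ((1 : Matrix (Fin m) (Fin m) ℝ) i j : ℝ) := by
    intro i j
    rw [← congrFun₂ A.2 i j]
    simp [PiLp.inner_apply, Matrix.mul_apply, mul_comm]
  suffices h : ∀ k ≤ m, ∃ S : spinStabilizer γ 0, ∀ i : Fin m, (i : ℕ) < k → rotation hγ S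
      (EuclideanSpace.single (Fin.castLE _ i) 1) = WithLp.toLp 2 (A.1 i) by
    obtain ⟨S, hS⟩ := h m le_rfl
    exact ⟨S, (frame_eq_iff hγ _).mpr fun i ↦ hS i i.2⟩
  intro k
  induction k with
  | zero => exact fun _ ↦ ⟨1, fun i hi ↦ absurd hi (Nat.not_lt_zero _)⟩
  | succ k ih =>
    intro hk
    obtain ⟨S, hS⟩ := ih (Nat.le_of_succ_le hk)
    set w := rotation hγ S⁻¹ (WithLp.toLp 2 (A.1 ⟨k, hk⟩)) with hw
    have hSw : WithLp.toLp 2 (A.1 ⟨k, hk⟩) = rotation hγ S w :=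
      (rotation_inv_apply_eq_iff hγ).mp rfl
    have hwn : ‖w‖ = 1 := by
      rw [← pow_left_inj₀ (norm_nonneg _) zero_le_one two_ne_zero, ← real_inner_self_eq_norm_sq,
        hw, inner_rotation, hA, Matrix.one_apply_eq, one_pow]
    have hwW : w ∈ tailSubspace n k := by
      intro i hi
      have h := hA ⟨i, hi.trans hk⟩ ⟨k, hk⟩
      rw [hSw, ← hS _ hi, inner_rotation, Matrix.one_apply_ne (by simpa using hi.ne)] at h
      simpa [EuclideanSpace.inner_single_left] using h
    obtain ⟨T, hT, hTw⟩ := exists_rotate_single_eq hγ (i := ⟨k, by omega⟩) (by simp; omega) hwW hwn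
    have hT₀ := spinStabilizer_anti (Nat.zero_le _) hT
    refine ⟨S * ⟨T, hT₀⟩, fun i hi ↦ ?_⟩
    rw [map_mul, Module.End.mul_apply]
    rcases Nat.lt_succ_iff_lt_or_eq.mp hi with hi | hi
    · rw [(coe_mem_spinStabilizer_iff hγ (S := ⟨T, hT₀⟩)).mp hT _ hi, hS i hi]
    · obtain rfl : i = ⟨k, hk⟩ := Fin.ext hi
      rw [hSw]
      exact congrArg (rotation hγ S) hTw

theorem exists_rotation_eq_neg (hγ : IsCliffordFamily γ) {q : ℕ} (hq : 2 * q ≤ n) :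
    ∃ S : spinStabilizer γ 0, S * S = (⟨-1, neg_one_mem_spinStabilizer⟩ : spinStabilizer γ 0) ^ q ∧
      ∀ i : Fin n, rotation hγ S (EuclideanSpace.single i 1) =
        if (i : ℕ) < 2 * q then -EuclideanSpace.single i 1 else EuclideanSpace.single i 1 := by
  induction q with
  | zero => exact ⟨1, by simp, fun i ↦ by simp⟩
  | succ q ih =>
    obtain ⟨S, hS, hSi⟩ := ih (by omega)
    let a : Fin n := ⟨2 * q, by omega⟩
    let b : Fin n := ⟨2 * q + 1, by omega⟩
    have hba : b ≠ a := by simp [a, b]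
    have he : ∀ i : Fin n, ‖(EuclideanSpace.single i 1 : EuclideanSpace ℝ (Fin n))‖ = 1 := by simp
    let R : spinStabilizer γ 0 := ⟨rotor hγ (he b) (he a), rotor_mem_spinStabilizer hγ _ _
      (single_mem_tailSubspace (Nat.zero_le _)) (single_mem_tailSubspace (Nat.zero_le _))⟩
    have hR : ((R : unitary M) : M) = γ b * γ a := by
      change vec γ _ * vec γ _ = _
      rw [vec_single, vec_single]
    have hRR : R * R = ⟨-1, neg_one_mem_spinStabilizer⟩ := by
      refine Subtype.ext (Subtype.ext ?_)
      change ((R : unitary M) : M) * ((R : unitary M) : M) = ((-1 : unitary M) : M)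
      rw [hR, Unitary.coe_neg]
      nth_rw 1 [hγ.anticomm hba]
      rw [neg_mul, mul_assoc, ← mul_assoc (γ b), hγ.mul_self, one_mul, hγ.mul_self]
      rfl
    have hRa : rotation hγ R (EuclideanSpace.single a 1) = -EuclideanSpace.single a 1 := by
      refine rotate_single_eq_neg hγ R.2.1 R.1.2 ?_
      rw [hR, hγ.anticomm hba, neg_mul, mul_assoc, hγ.anticomm hba]
    have hRb : rotation hγ R (EuclideanSpace.single b 1) = -EuclideanSpace.single b 1 := by
      refine rotate_single_eq_neg hγ R.2.1 R.1.2 ?_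
      rw [hR, mul_assoc, hγ.anticomm hba.symm, mul_neg]
    have hRi : ∀ i, i ≠ a → i ≠ b →
        rotation hγ R (EuclideanSpace.single i 1) = EuclideanSpace.single i 1 := by
      intro i hia hib
      refine (commute_iff_rotate_single hγ R.2.1 R.1.2 i).mp ?_
      exact commute_vec_mul_vec hγ (by simp [hib]) (by simp [hia])
    have hSR : Commute S R := by
      have hSγ : ∀ i : Fin n, 2 * q ≤ i → Commute ((S : unitary M) : M) (γ i) := by
        intro i hi
        refine (commute_iff_rotate_single hγ S.2.1 S.1.2 i).mpr ?_
        exact (hSi i).trans (if_neg (by omega))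
      refine Subtype.ext (Subtype.ext ?_)
      change ((S : unitary M) : M) * ((R : unitary M) : M) = (R : unitary M) * (S : unitary M)
      rw [hR]
      exact (hSγ b (Nat.le_succ _)).mul_right (hSγ a le_rfl)
    refine ⟨S * R, ?_, fun i ↦ ?_⟩
    · rw [hSR.symm.mul_mul_mul_comm, hS, hRR, pow_succ]
    · rw [map_mul, Module.End.mul_apply]
      by_cases hia : i = a
      · subst hia
        rw [hRa, map_neg, hSi, if_neg (by simp [a]), if_pos (by simp [a])]
      by_cases hib : i = b
      · subst hib
        rw [hRb, map_neg, hSi, if_neg (by simp [b]), if_pos (by simp [b]; omega)]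
      rw [hRi i hia hib, hSi]
      simp only [a, b, Fin.ext_iff] at hia hib
      congr 1
      apply propext
      omega

end Frames

section Topology

variable {n : ℕ} {M : Type*} [Ring M] [Algebra ℝ M] [StarRing M]
  {γ : Fin n → M} [TopologicalSpace M] [IsTopologicalRing M] [ContinuousStar M]
  [ContinuousSMul ℝ M] [T2Space M] [FiniteDimensional ℝ M]

theorem isClosed_isSpin : IsClosed {x : M | IsSpin γ x} := by
  have h₁ : IsClosed (evenSubalgebra γ Set.univ : Set M) :=
    (Subalgebra.toSubmodule (evenSubalgebra γ Set.univ)).closed_of_finiteDimensional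
  have h₂ : IsClosed (LinearMap.range (vec γ) : Set M) :=
    (LinearMap.range (vec γ)).closed_of_finiteDimensional
  have : {x : M | IsSpin γ x} = {x | x ∈ evenSubalgebra γ Set.univ} ∩
      ⋂ v, {x | x * vec γ v * star x ∈ LinearMap.range (vec γ)} := by
    ext x
    simp [IsSpin, eq_comm]
  rw [this]
  exact h₁.inter (isClosed_iInter fun v ↦ h₂.preimage (by fun_prop))

theorem isClosed_spinStabilizer_zero : IsClosed (spinStabilizer γ 0 : Set (unitary M)) := by
  have : (spinStabilizer γ 0 : Set (unitary M)) = {S : unitary M | IsSpin γ (S : M)} ∩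
      {S : unitary M | IsSpin γ (star (S : M))} := by
    ext S
    exact ⟨fun h ↦ ⟨h.1, h.2.1⟩, fun h ↦ ⟨h.1, h.2, fun i hi ↦ absurd hi (Nat.not_lt_zero _)⟩⟩
  rw [this]
  exact (isClosed_isSpin.preimage continuous_subtype_val).inter
    (isClosed_isSpin.preimage (continuous_subtype_val.star))

variable [Nontrivial M]

theorem continuous_frame (hγ : IsCliffordFamily γ) {m : ℕ} (hm : m ≤ n) :
    Continuous (frame hγ hm) := by
  refine Continuous.subtype_mk (continuous_matrix fun i j ↦ ?_) _
  have h := (continuous_rotate (γ := γ) (EuclideanSpace.single (Fin.castLE hm i) 1)).comp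
    (continuous_subtype_val.comp (continuous_subtype_val (p := (· ∈ spinStabilizer γ 0))))
  exact (EuclideanSpace.proj (𝕜 := ℝ) j).continuous.comp h

variable [StarModule ℝ M]

theorem isQuotientMap_frame [CompactSpace (unitary M)] (hγ : IsCliffordFamily γ) {m : ℕ}
    (hm : m + 1 ≤ n) : Topology.IsQuotientMap (frame hγ ((Nat.le_succ m).trans hm)) := by
  have : CompactSpace (spinStabilizer γ 0) :=
    isCompact_iff_compactSpace.mp isClosed_spinStabilizer_zero.isCompact
  have hc := continuous_frame hγ ((Nat.le_succ m).trans hm)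
  exact hc.isClosedMap.isQuotientMap hc (frame_surjective hγ hm)

theorem nonempty_fundamentalGroup_rProjStiefel_mulEquiv [CompactSpace (unitary M)]
    (hγ : IsCliffordFamily γ) (hn : 3 ≤ n) (hmod : n % 4 = 2 ∨ n % 4 = 3)
    (x : RProjStiefel n (n - 1)) :
    Nonempty (FundamentalGroup (RProjStiefel n (n - 1)) x ≃* Multiplicative (ZMod 4)) := by
  have hn' : n = n - 1 + 1 := by omega
  have := simplyConnectedSpace_spinStabilizer (k := 0) hγ (by omega)
  obtain ⟨Ω, hΩ, hΩi⟩ := exists_rotation_eq_neg hγ (q := n / 2) (by omega)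
  have hΩ' : ∀ i : Fin (n - 1), rotation hγ Ω (EuclideanSpace.single (Fin.castLE (by omega) i) 1) =
      -EuclideanSpace.single (Fin.castLE (by omega) i) 1 := by
    intro i
    rw [hΩi, if_pos]
    simp only [Fin.val_castLE]
    omega
  set z : spinStabilizer γ 0 := ⟨-1, neg_one_mem_spinStabilizer⟩ with hz
  have hzz : z * z = 1 := Subtype.ext (neg_mul_neg 1 1 |>.trans (one_mul 1))
  have hz1 : z ≠ 1 := by
    intro h
    have h₁ : (-1 : M) = 1 := congrArg (fun S : spinStabilizer γ 0 ↦ ((S : unitary M) : M)) h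
    have h₂ : (2 : ℝ) • (1 : M) = 0 := by
      rw [two_smul]
      nth_rw 1 [← h₁]
      exact neg_add_cancel 1
    simp at h₂
  have hΩz : Ω * Ω = z := by
    obtain ⟨r, hr⟩ : ∃ r, n / 2 = 2 * r + 1 := ⟨n / 4, by omega⟩
    rw [hΩ, hr, pow_succ, pow_mul, pow_two, hzz, one_pow, one_mul]
  have hord : orderOf Ω = 2 ^ (1 + 1) := by
    refine orderOf_eq_prime_pow ?_ ?_
    · rwa [pow_one, pow_two, hΩz]
    · rw [pow_succ, pow_one, pow_mul, pow_two, pow_two, hΩz, hzz]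
  have hzΩ : z ∈ Subgroup.zpowers Ω :=
    hΩz ▸ mul_mem (Subgroup.mem_zpowers Ω) (Subgroup.mem_zpowers Ω)
  let F := frame hγ ((Nat.le_succ (n - 1)).trans hn'.ge)
  have hF : ∀ S T, F S = F T ↔ S⁻¹ * T = 1 ∨ S⁻¹ * T = z := by
    intro S T
    refine (frame_eq_frame_iff hγ _).trans ⟨fun h ↦ ?_, ?_⟩
    · refine (eq_one_or_eq_neg_one_of_mem_spinStabilizer hγ hn' h).imp (fun h ↦ ?_) (fun h ↦ ?_)
      · exact Subtype.ext (Subtype.ext h)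
      · exact Subtype.ext (Subtype.ext h)
    · rintro (h | h) <;> rw [h]
      · exact one_mem _
      · exact neg_one_mem_spinStabilizer
  have hFΩ : ∀ S, (F (S * Ω)).1 = -(F S).1 := fun S ↦ frame_mul_eq_neg hγ _ hΩ'
  have hmk : ∀ A B : RStiefel n (n - 1), Quot.mk (fun A B : RStiefel n (n - 1) ↦ B.1 = -A.1) A =
      Quot.mk _ B → B = A ∨ B.1 = -A.1 := by
    intro A B h
    rw [Quot.eq] at h
    induction h with
    | rel _ _ h => exact Or.inr h
    | refl _ => exact Or.inl rfl
    | symm _ _ _ h => exact h.imp Eq.symm fun h ↦ by rw [h, neg_neg]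
    | trans _ _ _ _ _ h h' =>
      rcases h with rfl | h
      · exact h'
      · rcases h' with rfl | h'
        · exact Or.inr h
        · exact Or.inl (Subtype.ext (by rw [h', h, neg_neg]))
  refine nonempty_fundamentalGroup_mulEquiv_zmod (m := 4)
    (isQuotientMap_quot_mk.comp (isQuotientMap_frame hγ hn'.ge)) hord ?_ x
  intro S T
  constructor
  · intro h
    rcases hmk _ _ h with h | h
    · rcases (hF S T).mp h.symm with h | h <;> rw [h]
      · exact one_mem _
      · exact hzΩ
    · have h' : F (S * Ω) = F T := Subtype.ext ((hFΩ S).trans h.symm)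
      have h'' : S⁻¹ * T = Ω * ((S * Ω)⁻¹ * T) := by group
      rw [h'']
      refine mul_mem (Subgroup.mem_zpowers Ω) ?_
      rcases (hF _ T).mp h' with h | h <;> rw [h]
      · exact one_mem _
      · exact hzΩ
  · let π : spinStabilizer γ 0 → RProjStiefel n (n - 1) := fun S ↦ Quot.mk _ (F S)
    have hπ : ∀ S, π (S * Ω) = π S := fun S ↦
      (Quot.sound (r := fun A B : RStiefel n (n - 1) ↦ B.1 = -A.1) (hFΩ S)).symm
    have hpow : ∀ (k : ℕ) S, π (S * Ω ^ k) = π S := by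
      intro k
      induction k with
      | zero => simp
      | succ k ih => exact fun S ↦ by rw [pow_succ, ← mul_assoc, hπ, ih]
    intro h
    have hfin : IsOfFinOrder Ω := orderOf_pos_iff.mp (by rw [hord]; norm_num)
    obtain ⟨k, hk⟩ := hfin.mem_powers_iff_mem_zpowers.mpr h
    have := hpow k S
    rw [show Ω ^ k = S⁻¹ * T from hk, mul_inv_cancel_left] at this
    exact this.symm

end Topology

end CliffordFamily

theorem compactSpace_unitary_matrix (ι : Type*) [Fintype ι] [DecidableEq ι] :
    CompactSpace (unitary (Matrix ι ι ℝ)) := by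
  have h : IsCompact (unitary (Matrix ι ι ℝ) : Set (Matrix ι ι ℝ)) := by
    have hc : IsClosed (unitary (Matrix ι ι ℝ) : Set (Matrix ι ι ℝ)) := isClosed_unitary
    refine (isCompact_univ_pi fun _ : ι ↦ isCompact_univ_pi fun _ : ι ↦
      isCompact_Icc (a := (-1 : ℝ)) (b := 1)).of_isClosed_subset hc ?_
    intro A hA i _ j _
    exact abs_le.mp (entry_norm_bound_of_unitary hA i j)
  exact isCompact_iff_compactSpace.mp h

/-- For `n ≥ 3` with `n ≡ 2, 3 (mod 4)`, the fundamental group of the real projective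
Stiefel manifold `ℝX_{n,n-1}` (at any basepoint) is cyclic of order 4. -/
theorem stmt9 (n : ℕ) (hn : 3 ≤ n) (hmod : n % 4 = 2 ∨ n % 4 = 3) :
    ∀ x : RProjStiefel n (n - 1),
      Nonempty (FundamentalGroup (RProjStiefel n (n - 1)) x ≃* Multiplicative (ZMod 4)) := by
  intro x
  obtain ⟨N, hN, γ, hγ⟩ := exists_isCliffordFamily n
  have : Nonempty (Fin N) := ⟨⟨0, hN⟩⟩
  have := compactSpace_unitary_matrix (Fin N)
  exact CliffordFamily.nonempty_fundamentalGroup_rProjStiefel_mulEquiv hγ hn hmod x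
end
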